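/- arXiv:1903.05869 — 4 statements merged into one kernel-verified Lean document; each statement's English description precedes it below -/
import Mathlib

section
/- Let p : [0,1] → [1,∞] be Lebesgue measurable. Suppose: (i) f ∈ AAS^{p(x)}(ℝ×Y:X) and there exist a measurable r : [0,1] → [1,∞] with r(x) ≥ max(p(x), p(x)/(p(x)−1)) for a.e. x ∈ [0,1] and a nonnegative function L_f ∈ L_S^{r(x)}(ℝ:ℝ) such that ‖f(t,x) − f(t,y)‖ ≤ L_f(t)‖x−y‖_Y for all t ∈ ℝ and x, y ∈ Y; (ii) u ∈ AAS^{p(x)}(ℝ:Y) and there exists a Lebesgue-null set E ⊆ ℝ such that K := {u(t) : t ∈ ℝ \ E} is relatively compact in Y. Define q : [0,1] → [1,∞] by q(x) := p(x)r(x)/(p(x)+r(x)) when r(x) < ∞ and q(x) := p(x) when r(x) = ∞. Then q(x) ∈ [1, p(x)) for those x ∈ [0,1] with r(x) < ∞, and the function t ↦ f(t, u(t)) belongs to AAS^{q(x)}(ℝ:X). -/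
open MeasureTheory Filter Topology Set
open scoped ENNReal

noncomputable section

/-- φ_{p(x)}(t): t^{p(x)} if p(x) < ∞; if p(x) = ∞ then 0 for t ≤ 1 and ∞ for t > 1. -/
def phiVar (p : ℝ → ℝ≥0∞) (x : ℝ) (t : ℝ) : ℝ≥0∞ :=
  if p x ≠ ∞ then ENNReal.ofReal (t ^ (p x).toReal)
  else if t ≤ 1 then 0 else ∞

/-- ρ(u) := ∫_{[0,1]} φ_{p(x)}(u(x)) dx, for a scalar (norm-valued) function u. -/
def rhoVar (p : ℝ → ℝ≥0∞) (u : ℝ → ℝ) : ℝ≥0∞ :=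
  ∫⁻ x in Set.Icc (0:ℝ) 1, phiVar p x (u x)

/-- Membership in L^{p(x)}([0,1]:E). -/
def MemLpVar {E : Type*} [NormedAddCommGroup E] (p : ℝ → ℝ≥0∞) (f : ℝ → E) : Prop :=
  AEStronglyMeasurable f (volume.restrict (Set.Icc (0:ℝ) 1)) ∧
    ∃ c : ℝ, 0 < c ∧ rhoVar p (fun x => c * ‖f x‖) < ∞

/-- The Luxemburg norm of f in L^{p(x)}([0,1]:E). -/
def luxNorm {E : Type*} [NormedAddCommGroup E] (p : ℝ → ℝ≥0∞) (f : ℝ → E) : ℝ :=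
  sInf {lam : ℝ | 0 < lam ∧ rhoVar p (fun x => ‖f x‖ / lam) ≤ 1}

/-- Stepanov p(x)-boundedness on the interval I. -/
def SBdd {E : Type*} [NormedAddCommGroup E] (p : ℝ → ℝ≥0∞) (I : Set ℝ) (f : ℝ → E) : Prop :=
  (∀ t ∈ I, MemLpVar p (fun x => f (t + x))) ∧
    BddAbove ((fun t => luxNorm p (fun x => f (t + x))) '' I)

/-- The Stepanov norm ‖f‖_{S^{p(x)}} on the interval I. -/
def SNorm {E : Type*} [NormedAddCommGroup E] (p : ℝ → ℝ≥0∞) (I : Set ℝ) (f : ℝ → E) : ℝ :=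
  sSup ((fun t => luxNorm p (fun x => f (t + x))) '' I)

/-- Stepanov p(x)-almost automorphy (AAS^{p(x)}(ℝ:E)). -/
def AASVar {E : Type*} [NormedAddCommGroup E] (p : ℝ → ℝ≥0∞) (f : ℝ → E) : Prop :=
  SBdd p Set.univ f ∧
    ∀ a : ℕ → ℝ, ∃ n : ℕ → ℕ, StrictMono n ∧ ∃ g : ℝ → E, SBdd p Set.univ g ∧
      ∀ t : ℝ,
        Tendsto (fun k => luxNorm p (fun x => f (a (n k) + t + x) - g (t + x))) atTop (𝓝 0) ∧
        Tendsto (fun k => luxNorm p (fun x => g (t - a (n k) + x) - f (t + x))) atTop (𝓝 0)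

/-- The class S_0^{p(x)}([0,∞):E) of Stepanov vanishing functions. -/
def S0Var {E : Type*} [NormedAddCommGroup E] (p : ℝ → ℝ≥0∞) (f : ℝ → E) : Prop :=
  SBdd p (Set.Ici 0) f ∧ Tendsto (fun t => luxNorm p (fun x => f (t + x))) atTop (𝓝 0)

/-- Asymptotic Stepanov p(x)-almost automorphy (AAAS^{p(x)}([0,∞):E)). -/
def AAASVar {E : Type*} [NormedAddCommGroup E] (p : ℝ → ℝ≥0∞) (f : ℝ → E) : Prop :=
  SBdd p (Set.Ici 0) f ∧
    ∃ g q : ℝ → E, AASVar p g ∧ SBdd p (Set.Ici 0) q ∧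
      (∀ t : ℝ, 0 ≤ t → f t = g t + q t) ∧
      Tendsto (fun t => luxNorm p (fun x => q (t + x))) atTop (𝓝 0)

/-- Stepanov p(x)-almost periodicity on I: the map t ↦ f(t+·) is Bohr almost periodic
from I to L^{p(x)}([0,1]:E), i.e. continuous plus the relative density of ε-periods. -/
def APSVar {E : Type*} [NormedAddCommGroup E] (p : ℝ → ℝ≥0∞) (I : Set ℝ) (f : ℝ → E) : Prop :=
  SBdd p I f ∧
    (∀ t ∈ I, Tendsto (fun s => luxNorm p (fun x => f (s + x) - f (t + x))) (𝓝[I] t) (𝓝 0)) ∧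
    ∀ ε : ℝ, 0 < ε → ∃ l : ℝ, 0 < l ∧ ∀ a : ℝ, Set.Icc a (a + l) ⊆ I →
      ∃ τ ∈ Set.Icc a (a + l), ∀ t ∈ I, luxNorm p (fun x => f (t + τ + x) - f (t + x)) ≤ ε

/-- Almost automorphic function ℝ → E. -/
def AlmostAutomorphic {E : Type*} [NormedAddCommGroup E] (f : ℝ → E) : Prop :=
  Continuous f ∧
    ∀ b : ℕ → ℝ, ∃ n : ℕ → ℕ, StrictMono n ∧ ∃ g : ℝ → E,
      (∀ t : ℝ, Tendsto (fun k => f (t + b (n k))) atTop (𝓝 (g t))) ∧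
      (∀ t : ℝ, Tendsto (fun k => g (t - b (n k))) atTop (𝓝 (f t)))

/-- Compactly almost automorphic function ℝ → E. -/
def CompactAA {E : Type*} [NormedAddCommGroup E] (f : ℝ → E) : Prop :=
  Continuous f ∧
    ∀ b : ℕ → ℝ, ∃ n : ℕ → ℕ, StrictMono n ∧ ∃ g : ℝ → E,
      (∀ K : Set ℝ, IsCompact K →
        TendstoUniformlyOn (fun k t => f (t + b (n k))) g atTop K) ∧
      (∀ K : Set ℝ, IsCompact K →
        TendstoUniformlyOn (fun k t => g (t - b (n k))) f atTop K)

/-- Two-parameter Stepanov p(x)-almost automorphy (AAS^{p(x)}(ℝ×F:E)). -/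
def AAS2Var {E F : Type*} [NormedAddCommGroup E] [NormedAddCommGroup F]
    (p : ℝ → ℝ≥0∞) (f : ℝ → F → E) : Prop :=
  (∀ y : F, SBdd p Set.univ (fun t => f t y)) ∧
    ∀ a : ℕ → ℝ, ∃ n : ℕ → ℕ, StrictMono n ∧ ∃ g : ℝ → F → E,
      (∀ y : F, SBdd p Set.univ (fun t => g t y)) ∧
      ∀ (t : ℝ) (y : F),
        Tendsto (fun k => luxNorm p (fun x => f (t + a (n k) + x) y - g (t + x) y)) atTop (𝓝 0) ∧
        Tendsto (fun k => luxNorm p (fun x => g (t - a (n k) + x) y - f (t + x) y)) atTop (𝓝 0)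


/-- Restricted measure on the unit interval. -/
abbrev mu01 : Measure ℝ := volume.restrict (Set.Icc (0:ℝ) 1)

/-- extended-valued version of the integrand -/
def Ph (P a : ℝ≥0∞) : ℝ≥0∞ := if P ≠ ∞ then a ^ P.toReal else if a ≤ 1 then 0 else ∞

/-- extended-valued modular -/
def Rho (p : ℝ → ℝ≥0∞) (w : ℝ → ℝ≥0∞) : ℝ≥0∞ := ∫⁻ x, Ph (p x) (w x) ∂mu01

lemma Ph_mono (P : ℝ≥0∞) {a b : ℝ≥0∞} (h : a ≤ b) : Ph P a ≤ Ph P b := by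
  unfold Ph
  split_ifs with h1 h2 h3 h3
  · exact ENNReal.rpow_le_rpow h ENNReal.toReal_nonneg
  · simp
  · simp
  · exact absurd (h.trans h3) h2
  · simp

lemma Ph_scale {P : ℝ≥0∞} (hP : 1 ≤ P) {s a : ℝ≥0∞} (hs : s ≤ 1) :
    Ph P (s * a) ≤ s * Ph P a := by
  unfold Ph
  split_ifs with h1 h2 h3 h3
  · have h1' : 1 ≤ P.toReal := by
      have := ENNReal.toReal_mono h1 hP
      simpa using this
    rw [ENNReal.mul_rpow_of_nonneg _ _ ENNReal.toReal_nonneg]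
    gcongr
    calc s ^ P.toReal ≤ s ^ (1:ℝ) := ENNReal.rpow_le_rpow_of_exponent_ge hs h1'
      _ = s := ENNReal.rpow_one s
  · simp
  · simp
  · exfalso; apply h2
    calc s * a ≤ 1 * 1 := mul_le_mul' hs h3
      _ = 1 := one_mul 1
  · have : s ≠ 0 := by rintro rfl; simp at h2
    rw [ENNReal.mul_top this]

lemma Ph_half_add (P : ℝ≥0∞) (a b : ℝ≥0∞) : Ph P (2⁻¹ * (a + b)) ≤ Ph P a + Ph P b := by
  rcases le_total a b with h | h
  · refine (Ph_mono P ?_).trans le_add_self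
    calc 2⁻¹ * (a + b) ≤ 2⁻¹ * (b + b) := by gcongr
      _ = b := by rw [← two_mul, ← mul_assoc, ENNReal.inv_mul_cancel (by simp) (by simp), one_mul]
  · refine (Ph_mono P ?_).trans le_self_add
    calc 2⁻¹ * (a + b) ≤ 2⁻¹ * (a + a) := by gcongr
      _ = a := by rw [← two_mul, ← mul_assoc, ENNReal.inv_mul_cancel (by simp) (by simp), one_mul]

lemma Ph_embed {Q P : ℝ≥0∞} (h : Q ≤ P) (a : ℝ≥0∞) : Ph Q a ≤ 1 + Ph P a := by
  by_cases ha : a ≤ 1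
  · refine le_trans ?_ le_self_add
    unfold Ph
    split_ifs
    · exact ENNReal.rpow_le_one ha ENNReal.toReal_nonneg
    · simp
  · refine le_trans ?_ le_add_self
    unfold Ph
    split_ifs with h1 h2
    · exact ENNReal.rpow_le_rpow_of_exponent_le (not_le.1 ha).le (ENNReal.toReal_mono h2 h)
    all_goals simp_all

lemma le_one_add_Ph {P : ℝ≥0∞} (hP : 1 ≤ P) (a : ℝ≥0∞) : a ≤ 1 + Ph P a := by
  have := Ph_embed hP a
  simpa [Ph] using this

lemma Ph_meas {p w : ℝ → ℝ≥0∞} (hp : Measurable p) {m : Measure ℝ} (hw : AEMeasurable w m) :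
    AEMeasurable (fun x => Ph (p x) (w x)) m := by
  have : Measurable (fun z : ℝ≥0∞ × ℝ≥0∞ => Ph z.1 z.2) := by
    unfold Ph
    refine Measurable.ite ?_ ?_ (Measurable.ite ?_ ?_ ?_)
    · exact (measurableSet_singleton (∞:ℝ≥0∞)).compl.preimage measurable_fst
    · fun_prop
    · exact measurableSet_Iic.preimage measurable_snd
    · fun_prop
    · fun_prop
  exact this.comp_aemeasurable (hp.aemeasurable.prodMk hw)

lemma Ph_holder {P R Q : ℝ≥0∞} (hP : 1 ≤ P) (hR : 1 ≤ R) (hPR : P ≤ R)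
    (hQ : (R ≠ ∞ → Q = P * R / (P + R)) ∧ (R = ∞ → Q = P)) (a b : ℝ≥0∞) :
    Ph Q (a * b) ≤ Ph P a + Ph R b := by
  by_cases hRt : R = ∞
  · rw [hQ.2 hRt]
    by_cases hb : b ≤ 1
    · refine le_trans (Ph_mono P ?_) le_self_add
      exact mul_le_of_le_one_right' hb
    · simp [Ph, hRt, hb]
  · have hPt : P ≠ ∞ := ne_top_of_le_ne_top hRt hPR
    have hQ' := hQ.1 hRt
    lift P to NNReal using hPt
    lift R to NNReal using hRt
    have hP0 : 0 < P := lt_of_lt_of_le one_pos (by exact_mod_cast hP)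
    have hR0 : 0 < R := lt_of_lt_of_le one_pos (by exact_mod_cast hR)
    have hQ2 : Q = ((P * R / (P + R) : NNReal) : ℝ≥0∞) := by
      rw [hQ', ENNReal.coe_div (by positivity)]; push_cast; rfl
    have hP0' : (0:ℝ) < P := by exact_mod_cast hP0
    have hR0' : (0:ℝ) < R := by exact_mod_cast hR0
    subst hQ2
    simp only [Ph, ne_eq, ENNReal.coe_ne_top, not_false_eq_true, if_true, ENNReal.coe_toReal]
    set M := a ^ (P:ℝ) + b ^ (R:ℝ) with hM
    have ha : a ≤ M ^ (1/(P:ℝ)) := by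
      rw [one_div, ENNReal.le_rpow_inv_iff hP0']; exact le_self_add
    have hb : b ≤ M ^ (1/(R:ℝ)) := by
      rw [one_div, ENNReal.le_rpow_inv_iff hR0']; exact le_add_self
    calc (a * b) ^ ((P * R / (P + R) : NNReal) : ℝ)
        ≤ (M ^ (1/(P:ℝ)) * M ^ (1/(R:ℝ))) ^ ((P * R / (P + R) : NNReal) : ℝ) := by gcongr
      _ = M := by
        rw [← ENNReal.rpow_add_of_nonneg _ _ (by positivity) (by positivity), ← ENNReal.rpow_mul]
        have : (1 / (P:ℝ) + 1 / (R:ℝ)) * ((P * R / (P + R) : NNReal) : ℝ) = 1 := by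
          push_cast; field_simp; ring
        rw [this, ENNReal.rpow_one]

instance : IsProbabilityMeasure mu01 := ⟨by simp [mu01]⟩

lemma Rho_mono {p : ℝ → ℝ≥0∞} {w w' : ℝ → ℝ≥0∞} (h : ∀ᵐ x ∂mu01, w x ≤ w' x) :
    Rho p w ≤ Rho p w' := by
  refine lintegral_mono_ae ?_
  filter_upwards [h] with x hx using Ph_mono _ hx

lemma Rho_scale {p : ℝ → ℝ≥0∞} (hp : ∀ᵐ x ∂mu01, 1 ≤ p x) {w : ℝ → ℝ≥0∞} {s : ℝ≥0∞}
    (hs : s ≤ 1) : Rho p (fun x => s * w x) ≤ s * Rho p w := by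
  unfold Rho
  rw [← lintegral_const_mul' _ _ (ne_top_of_le_ne_top ENNReal.one_ne_top hs)]
  refine lintegral_mono_ae ?_
  filter_upwards [hp] with x hx using Ph_scale hx hs

lemma Rho_half {p : ℝ → ℝ≥0∞} (hp : ∀ᵐ x ∂mu01, 1 ≤ p x) {w : ℝ → ℝ≥0∞}
    (h : Rho p w ≤ 2) : Rho p (fun x => 2⁻¹ * w x) ≤ 1 := by
  refine (Rho_scale hp (by simp)).trans ?_
  calc 2⁻¹ * Rho p w ≤ 2⁻¹ * 2 := by gcongr
    _ = 1 := ENNReal.inv_mul_cancel (by simp) (by simp)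

lemma Rho_add {p : ℝ → ℝ≥0∞} (hp : ∀ᵐ x ∂mu01, 1 ≤ p x) (hpm : Measurable p)
    {w w' : ℝ → ℝ≥0∞} (hw : AEMeasurable w mu01) (c : ℝ≥0∞)
    (h1 : Rho p (fun x => 4 * c * w x) ≤ 1) (h2 : Rho p (fun x => 4 * c * w' x) ≤ 1) :
    Rho p (fun x => c * (w x + w' x)) ≤ 1 := by
  have h3 : Rho p (fun x => 2⁻¹ * (4 * c * w x + 4 * c * w' x)) ≤ 2 := by
    calc _ ≤ ∫⁻ x, (Ph (p x) (4 * c * w x) + Ph (p x) (4 * c * w' x)) ∂mu01 :=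
          lintegral_mono fun x => Ph_half_add _ _ _
      _ = Rho p (fun x => 4 * c * w x) + Rho p (fun x => 4 * c * w' x) :=
          lintegral_add_left' (Ph_meas hpm (hw.const_mul _)) _
      _ ≤ 1 + 1 := add_le_add h1 h2
      _ = 2 := one_add_one_eq_two
  refine le_of_eq_of_le ?_ (Rho_half hp h3)
  congr 1; ext x
  have : (2⁻¹ * 2⁻¹ * 4 : ℝ≥0∞) = 1 := by
    have e : (4:ℝ≥0∞) = 2 * 2 := by norm_num
    rw [e, mul_assoc, ← mul_assoc 2⁻¹ 2 2, ENNReal.inv_mul_cancel (by simp) (by simp), one_mul,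
      ENNReal.inv_mul_cancel (by simp) (by simp)]
  calc c * (w x + w' x) = (2⁻¹ * 2⁻¹ * 4) * (c * (w x + w' x)) := by rw [this, one_mul]
    _ = _ := by ring

lemma Rho_embed {p q : ℝ → ℝ≥0∞} (hq : ∀ᵐ x ∂mu01, 1 ≤ q x) (hqp : ∀ᵐ x ∂mu01, q x ≤ p x)
    {w : ℝ → ℝ≥0∞} (c : ℝ≥0∞)
    (h1 : Rho p (fun x => 2 * c * w x) ≤ 1) : Rho q (fun x => c * w x) ≤ 1 := by
  have h3 : Rho q (fun x => 2 * c * w x) ≤ 2 := by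
    calc _ ≤ ∫⁻ x, (1 + Ph (p x) (2 * c * w x)) ∂mu01 := by
          refine lintegral_mono_ae ?_
          filter_upwards [hqp] with x hx using Ph_embed hx _
      _ = 1 + Rho p (fun x => 2 * c * w x) := by
          rw [lintegral_add_left measurable_const]; simp [Rho]
      _ ≤ 1 + 1 := add_le_add le_rfl h1
      _ = 2 := one_add_one_eq_two
  refine le_of_eq_of_le ?_ (Rho_half hq h3)
  congr 1; ext x
  rw [mul_assoc, ← mul_assoc, ENNReal.inv_mul_cancel (by simp) (by simp), one_mul]

lemma lintegral_le_of_Rho {p : ℝ → ℝ≥0∞} (hp : ∀ᵐ x ∂mu01, 1 ≤ p x) 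
    {w : ℝ → ℝ≥0∞} (h1 : Rho p w ≤ 1) : ∫⁻ x, w x ∂mu01 ≤ 2 := by
  calc _ ≤ ∫⁻ x, (1 + Ph (p x) (w x)) ∂mu01 := by
          refine lintegral_mono_ae ?_
          filter_upwards [hp] with x hx using le_one_add_Ph hx _
      _ = 1 + Rho p w := by
          rw [lintegral_add_left measurable_const]; simp [Rho]
      _ ≤ 1 + 1 := add_le_add le_rfl h1
      _ = 2 := one_add_one_eq_two

/-- the standing assumptions on exponents -/
structure Expo (p r q : ℝ → ℝ≥0∞) : Prop where
  pm : Measurable p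
  rm : Measurable r
  qm : Measurable q
  p1 : ∀ᵐ x ∂mu01, 1 ≤ p x
  r1 : ∀ᵐ x ∂mu01, 1 ≤ r x
  q1 : ∀ᵐ x ∂mu01, 1 ≤ q x
  pr : ∀ᵐ x ∂mu01, p x ≤ r x
  qp : ∀ᵐ x ∂mu01, q x ≤ p x
  qd : ∀ x, (r x ≠ ∞ → q x = p x * r x / (p x + r x)) ∧ (r x = ∞ → q x = p x)

lemma Rho_holder {p r q : ℝ → ℝ≥0∞} (h : Expo p r q) {w w' : ℝ → ℝ≥0∞}
    (hw : AEMeasurable w mu01) (a b : ℝ≥0∞)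
    (h1 : Rho p (fun x => 2 * a * w x) ≤ 1) (h2 : Rho r (fun x => b * w' x) ≤ 1) :
    Rho q (fun x => (a * b) * (w x * w' x)) ≤ 1 := by
  have h3 : Rho q (fun x => (2 * a * w x) * (b * w' x)) ≤ 2 := by
    calc _ ≤ ∫⁻ x, (Ph (p x) (2 * a * w x) + Ph (r x) (b * w' x)) ∂mu01 := by
          refine lintegral_mono_ae ?_
          filter_upwards [h.p1, h.r1, h.pr] with x h1 h2 h3 using Ph_holder h1 h2 h3 (h.qd x) _ _
      _ = Rho p (fun x => 2 * a * w x) + Rho r (fun x => b * w' x) :=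
          lintegral_add_left' (Ph_meas h.pm (hw.const_mul _)) _
      _ ≤ 1 + 1 := add_le_add h1 h2
      _ = 2 := one_add_one_eq_two
  refine le_of_eq_of_le ?_ (Rho_half h.q1 h3)
  congr 1; ext x
  calc (a * b) * (w x * w' x) = (2⁻¹ * 2) * ((a * b) * (w x * w' x)) := by
        rw [ENNReal.inv_mul_cancel (by simp) (by simp), one_mul]
    _ = _ := by ring

/-- uniformly bounded family -/
def Bd {ι : Type*} (p : ℝ → ℝ≥0∞) (w : ι → ℝ → ℝ≥0∞) : Prop :=
  ∃ c : NNReal, 0 < c ∧ ∀ i, Rho p (fun x => c * w i x) ≤ 1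

/-- null sequence -/
def NS (p : ℝ → ℝ≥0∞) (w : ℕ → ℝ → ℝ≥0∞) : Prop :=
  ∀ c : NNReal, ∀ᶠ k in atTop, Rho p (fun x => c * w k x) ≤ 1

lemma Rho_const_mono {p : ℝ → ℝ≥0∞} {w : ℝ → ℝ≥0∞} {c d : ℝ≥0∞} (h : c ≤ d)
    (h1 : Rho p (fun x => d * w x) ≤ 1) : Rho p (fun x => c * w x) ≤ 1 :=
  (Rho_mono (Eventually.of_forall fun x => by gcongr)).trans h1

lemma Bd.mono {ι : Type*} {p : ℝ → ℝ≥0∞} {w w' : ι → ℝ → ℝ≥0∞} (h : Bd p w')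
    (hm : ∀ i, ∀ᵐ x ∂mu01, w i x ≤ w' i x) : Bd p w := by
  obtain ⟨c, hc, h⟩ := h
  refine ⟨c, hc, fun i => (Rho_mono ?_).trans (h i)⟩
  filter_upwards [hm i] with x hx
  gcongr

lemma Bd.comp {ι κ : Type*} {p : ℝ → ℝ≥0∞} {w : ι → ℝ → ℝ≥0∞} (h : Bd p w) (e : κ → ι) :
    Bd p (fun k => w (e k)) := by
  obtain ⟨c, hc, h⟩ := h
  exact ⟨c, hc, fun k => h (e k)⟩

lemma Bd.add {ι : Type*} {p : ℝ → ℝ≥0∞} (hp : ∀ᵐ x ∂mu01, 1 ≤ p x) (hpm : Measurable p)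
    {w w' : ι → ℝ → ℝ≥0∞} (h : Bd p w) (h' : Bd p w') (hw : ∀ i, AEMeasurable (w i) mu01) :
    Bd p (fun i x => w i x + w' i x) := by
  obtain ⟨c, hc, h⟩ := h
  obtain ⟨d, hd, h'⟩ := h'
  have e : (4 : ℝ≥0∞) * ((min c d / 4 : NNReal) : ℝ≥0∞) = ((min c d : NNReal) : ℝ≥0∞) := by
    rw [show (4:ℝ≥0∞) = ((4:NNReal) : ℝ≥0∞) by norm_num, ← ENNReal.coe_mul]
    congr 1
    field_simp
  refine ⟨min c d / 4, by positivity, fun i => Rho_add hp hpm (hw i) _ ?_ ?_⟩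
  · rw [e]; exact Rho_const_mono (by exact_mod_cast min_le_left _ _) (h i)
  · rw [e]; exact Rho_const_mono (by exact_mod_cast min_le_right _ _) (h' i)

lemma Bd.embed {ι : Type*} {p q : ℝ → ℝ≥0∞} (hq : ∀ᵐ x ∂mu01, 1 ≤ q x)
    (hqp : ∀ᵐ x ∂mu01, q x ≤ p x) {w : ι → ℝ → ℝ≥0∞} (h : Bd p w) : Bd q w := by
  obtain ⟨c, hc, h⟩ := h
  have e : (2 : ℝ≥0∞) * ((c / 2 : NNReal) : ℝ≥0∞) = c := by
    rw [show (2:ℝ≥0∞) = ((2:NNReal) : ℝ≥0∞) by norm_num, ← ENNReal.coe_mul]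
    congr 1
    field_simp
  exact ⟨c / 2, by positivity, fun i => Rho_embed hq hqp _ (by rw [e]; exact h i)⟩

lemma Bd.const_mul {ι : Type*} {p : ℝ → ℝ≥0∞} {w : ι → ℝ → ℝ≥0∞} (h : Bd p w) (R : NNReal) :
    Bd p (fun i x => R * w i x) := by
  obtain ⟨c, hc, h⟩ := h
  refine ⟨c / (R + 1), by positivity, fun i => (Rho_mono ?_).trans (h i)⟩
  refine Eventually.of_forall fun x => ?_
  show ((c / (R + 1) : NNReal) : ℝ≥0∞) * (R * w i x) ≤ c * w i x
  rw [← mul_assoc, ← ENNReal.coe_mul]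
  gcongr
  rw [div_mul_eq_mul_div, div_le_iff₀ (by positivity)]
  gcongr
  simp

lemma NS.mono {p : ℝ → ℝ≥0∞} {w w' : ℕ → ℝ → ℝ≥0∞} (h : NS p w')
    (hm : ∀ i, ∀ᵐ x ∂mu01, w i x ≤ w' i x) : NS p w := by
  intro c
  filter_upwards [h c] with k hk
  refine (Rho_mono ?_).trans hk
  filter_upwards [hm k] with x hx
  gcongr

lemma NS.add {p : ℝ → ℝ≥0∞} (hp : ∀ᵐ x ∂mu01, 1 ≤ p x) (hpm : Measurable p)
    {w w' : ℕ → ℝ → ℝ≥0∞} (h : NS p w) (h' : NS p w') (hw : ∀ i, AEMeasurable (w i) mu01) :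
    NS p (fun i x => w i x + w' i x) := by
  intro c
  filter_upwards [h (4 * c), h' (4 * c)] with k h1 h2
  push_cast at h1 h2
  exact Rho_add hp hpm (hw k) _ h1 h2

lemma NS.embed {p q : ℝ → ℝ≥0∞} (hq : ∀ᵐ x ∂mu01, 1 ≤ q x)
    (hqp : ∀ᵐ x ∂mu01, q x ≤ p x) {w : ℕ → ℝ → ℝ≥0∞} (h : NS p w) : NS q w := by
  intro c
  filter_upwards [h (2 * c)] with k h1
  push_cast at h1
  exact Rho_embed hq hqp _ h1

lemma NS.zero {p : ℝ → ℝ≥0∞} (hp : ∀ᵐ x ∂mu01, 1 ≤ p x) : NS p (fun _ _ => 0) := by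
  intro c
  refine Eventually.of_forall fun k => ?_
  have := Rho_scale (s := 0) (w := fun _ => 0) hp (by simp)
  simp at this
  simp [this]

lemma NS.sum {p : ℝ → ℝ≥0∞} (hp : ∀ᵐ x ∂mu01, 1 ≤ p x) (hpm : Measurable p)
    {D : ℕ → ℕ → ℝ → ℝ≥0∞} (h : ∀ i, NS p (D i)) (hm : ∀ i k, AEMeasurable (D i k) mu01)
    (m : Finset ℕ) : NS p (fun k x => ∑ i ∈ m, D i k x) := by
  classical
  induction m using Finset.induction_on with
  | empty => simpa using NS.zero hp
  | insert a s ha ih =>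
    simp only [Finset.sum_insert ha]
    exact NS.add hp hpm (h a) ih (hm a)

lemma NS.holder {p r q : ℝ → ℝ≥0∞} (h : Expo p r q) {A d : ℕ → ℝ → ℝ≥0∞}
    (hd : NS p d) (hA : Bd r A) (hm : ∀ k, AEMeasurable (d k) mu01) :
    NS q (fun k x => d k x * A k x) := by
  intro c
  obtain ⟨b, hb, hA⟩ := hA
  filter_upwards [hd (2 * (c / b))] with k hk
  have e : (c : ℝ≥0∞) = ((c / b : NNReal) : ℝ≥0∞) * b := by
    rw [← ENNReal.coe_mul]; congr 1; field_simp
  rw [e]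
  rw [ENNReal.coe_mul] at hk
  exact Rho_holder h (hm k) _ _ hk (hA k)

lemma NS_core {p r q : ℝ → ℝ≥0∞} (h : Expo p r q) {A d W : ℕ → ℝ → ℝ≥0∞}
    {D : ℕ → ℕ → ℝ → ℝ≥0∞} (hd : NS p d) (hA : Bd r A) (hD : ∀ i, NS p (D i))
    (hmA : ∀ k, AEMeasurable (A k) mu01)
    (hmd : ∀ k, AEMeasurable (d k) mu01) (hmD : ∀ i k, AEMeasurable (D i k) mu01)
    (hW : ∀ ε : NNReal, 0 < ε → ∃ m : Finset ℕ, ∀ k, ∀ᵐ x ∂mu01, ∃ i ∈ m,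
      W k x ≤ A k x * (d k x + ε) + D i k x) : NS q W := by
  intro c
  obtain ⟨a, ha, hAq⟩ := (hA.embed h.p1 h.pr).embed h.q1 h.qp
  obtain ⟨m, hm⟩ := hW (a / (4 * (c + 1))) (by positivity)
  have h1 := (NS.holder h hd hA hmd).add h.q1 h.qm
    (NS.sum h.q1 h.qm (fun i => (hD i).embed h.q1 h.qp) hmD m) (fun k => (hmd k).mul (hmA k))
  filter_upwards [h1 (4 * c)] with k hk
  rw [ENNReal.coe_mul] at hk
  refine (Rho_mono ?_).trans (Rho_add h.q1 h.qm (w' := fun x =>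
    ((a / (4 * (c + 1)) : NNReal) : ℝ≥0∞) * A k x) ?_ c hk ?_)
  · filter_upwards [hm k] with x hx
    obtain ⟨i, hi, hx⟩ := hx
    gcongr
    refine hx.trans ?_
    have : D i k x ≤ ∑ i ∈ m, D i k x :=
      Finset.single_le_sum (f := fun i => D i k x) (fun _ _ => zero_le) hi
    calc _ ≤ A k x * (d k x + ((a / (4 * (c + 1)) : NNReal) : ℝ≥0∞)) + ∑ i ∈ m, D i k x := by gcongr
      _ = _ := by ring
  · exact ((hmd k).mul (hmA k)).add (Finset.aemeasurable_fun_sum m fun i _ => hmD i k)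
  · refine (Rho_mono (Eventually.of_forall fun x => ?_)).trans (hAq k)
    show 4 * (c:ℝ≥0∞) * (((a / (4 * (c + 1)) : NNReal) : ℝ≥0∞) * A k x) ≤ a * A k x
    rw [← mul_assoc, show (4:ℝ≥0∞) = ((4:NNReal) : ℝ≥0∞) by norm_num, ← ENNReal.coe_mul,
      ← ENNReal.coe_mul]
    gcongr
    rw [mul_div_assoc', div_le_iff₀ (by positivity)]
    calc 4 * c * a = a * (4 * c) := by ring
      _ ≤ a * (4 * (c + 1)) := by gcongr; simp

lemma rhoVar_eq (p : ℝ → ℝ≥0∞) {w : ℝ → ℝ} (hw : ∀ x, 0 ≤ w x) :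
    rhoVar p w = Rho p (fun x => ENNReal.ofReal (w x)) := by
  unfold rhoVar Rho phiVar Ph
  refine lintegral_congr fun x => ?_
  simp only [ENNReal.ofReal_le_one]
  rw [ENNReal.ofReal_rpow_of_nonneg (hw x) ENNReal.toReal_nonneg]

lemma rhoVar_mul {E : Type*} [NormedAddCommGroup E] (p : ℝ → ℝ≥0∞) (f : ℝ → E) {c : ℝ}
    (hc : 0 ≤ c) :
    rhoVar p (fun x => c * ‖f x‖) = Rho p (fun x => ENNReal.ofReal c * ‖f x‖ₑ) := by
  rw [rhoVar_eq p (fun x => by positivity)]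
  congr 1; ext x
  rw [ENNReal.ofReal_mul hc, ofReal_norm]

lemma rhoVar_div {E : Type*} [NormedAddCommGroup E] (p : ℝ → ℝ≥0∞) (f : ℝ → E) {l : ℝ}
    (hl : 0 < l) :
    rhoVar p (fun x => ‖f x‖ / l) = Rho p (fun x => ENNReal.ofReal l⁻¹ * ‖f x‖ₑ) := by
  rw [← rhoVar_mul p f (by positivity)]
  congr 1; ext x
  rw [div_eq_inv_mul]

lemma lux_nonneg {E : Type*} [NormedAddCommGroup E] (p : ℝ → ℝ≥0∞) (f : ℝ → E) :
    0 ≤ luxNorm p f := Real.sInf_nonneg fun _ h => h.1.le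

lemma lux_le {E : Type*} [NormedAddCommGroup E] {p : ℝ → ℝ≥0∞} {f : ℝ → E} {l : ℝ} (hl : 0 < l)
    (h : Rho p (fun x => ENNReal.ofReal l⁻¹ * ‖f x‖ₑ) ≤ 1) : luxNorm p f ≤ l := by
  refine csInf_le ⟨0, fun _ h => h.1.le⟩ ⟨hl, ?_⟩
  rwa [rhoVar_div p f hl]

lemma lux_lt {E : Type*} [NormedAddCommGroup E] {p : ℝ → ℝ≥0∞}
    {f : ℝ → E} (hne : ∃ c : NNReal, 0 < c ∧ Rho p (fun x => c * ‖f x‖ₑ) ≤ 1)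
    {l : ℝ} (hl : luxNorm p f < l) :
    Rho p (fun x => ENNReal.ofReal l⁻¹ * ‖f x‖ₑ) ≤ 1 := by
  obtain ⟨c, hc, h⟩ := hne
  have : {lam : ℝ | 0 < lam ∧ rhoVar p (fun x => ‖f x‖ / lam) ≤ 1}.Nonempty := by
    refine ⟨(c:ℝ)⁻¹, by positivity, ?_⟩
    rw [rhoVar_div p f (by positivity)]
    simpa using h
  obtain ⟨l', ⟨h1, h2⟩, h3⟩ := exists_lt_of_csInf_lt this hl
  rw [rhoVar_div p f h1] at h2
  refine Rho_const_mono ?_ h2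
  gcongr

lemma MemLpVar.ne {E : Type*} [NormedAddCommGroup E] {p : ℝ → ℝ≥0∞}
    (hp : ∀ᵐ x ∂mu01, 1 ≤ p x) {f : ℝ → E} (h : MemLpVar p f) :
    ∃ c : NNReal, 0 < c ∧ Rho p (fun x => c * ‖f x‖ₑ) ≤ 1 := by
  obtain ⟨-, c, hc, h⟩ := h
  rw [rhoVar_mul p f hc.le] at h
  obtain ⟨R, hR⟩ : ∃ R : NNReal, (R : ℝ≥0∞) = Rho p (fun x => ENNReal.ofReal c * ‖f x‖ₑ) :=
    ⟨_, ENNReal.coe_toNNReal h.ne⟩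
  have hs : (((R + 1)⁻¹ : NNReal) : ℝ≥0∞) ≤ 1 := by
    have : (R + 1)⁻¹ ≤ 1 := inv_le_one_of_one_le₀ (by simp)
    exact_mod_cast this
  have := Rho_scale (w := fun x => ENNReal.ofReal c * ‖f x‖ₑ) hp hs
  refine ⟨(R + 1)⁻¹ * c.toNNReal, by have := Real.toNNReal_pos.2 hc; positivity, ?_⟩
  rw [← hR] at this
  refine le_trans (le_of_eq_of_le ?_ this) ?_
  · congr 1; ext x; rw [ENNReal.coe_mul, mul_assoc]; rfl
  · rw [← ENNReal.coe_mul]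
    have : (R + 1)⁻¹ * R ≤ 1 := by
      rw [inv_mul_le_iff₀ (by positivity)]; simp
    exact_mod_cast this

lemma SBdd.bd {E : Type*} [NormedAddCommGroup E] {p : ℝ → ℝ≥0∞}
    (hp : ∀ᵐ x ∂mu01, 1 ≤ p x) {f : ℝ → E} (h : SBdd p Set.univ f) :
    Bd p (fun t x => ‖f (t + x)‖ₑ) := by
  obtain ⟨h1, C, hC⟩ := h
  have hl : 0 < max C 0 + 1 := by positivity
  refine ⟨(max C 0 + 1)⁻¹.toNNReal, Real.toNNReal_pos.2 (by positivity), fun t => ?_⟩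
  refine lux_lt ((h1 t (mem_univ t)).ne hp) ?_
  have := hC ⟨t, mem_univ t, rfl⟩
  simp only at this
  exact (this.trans (le_max_left _ _)).trans_lt (lt_add_one _)

lemma aesm_of_shift {E : Type*} [NormedAddCommGroup E] {f : ℝ → E}
    (h : ∀ t : ℝ, AEStronglyMeasurable (fun x => f (t + x)) mu01) :
    AEStronglyMeasurable f volume := by
  have h1 : ∀ n : ℤ, AEStronglyMeasurable f (volume.restrict (Icc (n:ℝ) (n + 1))) := by
    intro n
    have := h n
    have mp := (measurePreserving_add_left (volume : Measure ℝ) (-(n:ℝ))).restrict_preimage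
      (measurableSet_Icc (a := (0:ℝ)) (b := 1))
    have h2 := this.comp_measurePreserving mp
    have e : (fun x => -(n:ℝ) + x) ⁻¹' Icc 0 1 = Icc (n:ℝ) (n+1) := by
      ext x; simp only [mem_preimage, mem_Icc]; constructor <;> rintro ⟨a, b⟩ <;> constructor <;> linarith
    rw [e] at h2
    exact h2.congr (Eventually.of_forall fun x => by simp)
  have h2 := aestronglyMeasurable_iUnion_iff.2 h1
  have : (⋃ n : ℤ, Icc (n:ℝ) (n + 1)) = univ := by
    exact iUnion_Icc_intCast ℝ
  rwa [this, Measure.restrict_univ] at h2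

lemma ae_shift {P : ℝ → Prop} (h : ∀ᵐ s, P s) (t : ℝ) : ∀ᵐ x ∂mu01, P (t + x) :=
  ae_restrict_of_ae ((measurePreserving_add_left (volume : Measure ℝ) t).quasiMeasurePreserving.ae h)

lemma ae_shift' {P : ℝ → Prop} (h : ∀ᵐ s, P s) (t : ℝ) : ∀ᵐ x, P (x + t) :=
  ((measurePreserving_add_right (volume : Measure ℝ) t).quasiMeasurePreserving.ae h)

lemma ae_of_shift {P : ℝ → Prop} (h : ∀ n : ℤ, ∀ᵐ x ∂mu01, P (n + x)) : ∀ᵐ s, P s := by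
  have h1 : ∀ n : ℤ, ∀ᵐ x ∂(volume.restrict (Icc (n:ℝ) (n + 1))), P x := by
    intro n
    have mp := (measurePreserving_add_left (volume : Measure ℝ) (-(n:ℝ))).restrict_preimage
      (measurableSet_Icc (a := (0:ℝ)) (b := 1))
    have h2 := mp.quasiMeasurePreserving.ae (h n)
    have e : (fun x => -(n:ℝ) + x) ⁻¹' Icc 0 1 = Icc (n:ℝ) (n+1) := by
      ext x; simp only [mem_preimage, mem_Icc]; constructor <;> rintro ⟨a, b⟩ <;> constructor <;> linarith
    rw [e] at h2
    filter_upwards [h2] with x hx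
    simpa using hx
  have h2 := (ae_restrict_iUnion_iff _ _).2 h1
  have : (⋃ n : ℤ, Icc (n:ℝ) (n + 1)) = univ := by
    exact iUnion_Icc_intCast ℝ
  rwa [this, Measure.restrict_univ] at h2

lemma aesm_shift {E : Type*} [TopologicalSpace E] {f : ℝ → E}
    (h : AEStronglyMeasurable f volume) (t : ℝ) :
    AEStronglyMeasurable (fun x => f (t + x)) mu01 :=
  (h.comp_measurePreserving (measurePreserving_add_left (volume : Measure ℝ) t)).restrict

lemma aem_shift {f : ℝ → ℝ≥0∞}
    (h : AEMeasurable f volume) (t : ℝ) :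
    AEMeasurable (fun x => f (t + x)) mu01 :=
  (h.comp_quasiMeasurePreserving
    (measurePreserving_add_left (volume : Measure ℝ) t).quasiMeasurePreserving).restrict

lemma SBdd.aesm {E : Type*} [NormedAddCommGroup E] {p : ℝ → ℝ≥0∞}
    {f : ℝ → E} (h : SBdd p Set.univ f) : AEStronglyMeasurable f volume :=
  aesm_of_shift fun t => (h.1 t (mem_univ t)).1

lemma SBdd.of_bd {E : Type*} [NormedAddCommGroup E] {p : ℝ → ℝ≥0∞}
    {f : ℝ → E} (hm : AEStronglyMeasurable f volume) (h : Bd p (fun t x => ‖f (t + x)‖ₑ)) :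
    SBdd p Set.univ f := by
  obtain ⟨c, hc, h⟩ := h
  refine ⟨fun t _ => ⟨aesm_shift hm t, c, by exact_mod_cast hc, ?_⟩, (c:ℝ)⁻¹, ?_⟩
  · refine lt_of_eq_of_lt (rhoVar_mul p (fun x => f (t + x)) c.2) ?_
    refine lt_of_le_of_lt (b := 1) ?_ (by simp)
    simpa using h t
  · rintro _ ⟨t, -, rfl⟩
    refine lux_le (by positivity) ?_
    simpa using h t

lemma tendsto_lux {E : Type*} [NormedAddCommGroup E] {p : ℝ → ℝ≥0∞} {f : ℕ → ℝ → E}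
    (h : NS p (fun k x => ‖f k x‖ₑ)) : Tendsto (fun k => luxNorm p (f k)) atTop (𝓝 0) := by
  rw [Metric.tendsto_atTop']
  intro ε hε
  obtain ⟨N, hN⟩ := eventually_atTop.1 (h ((ε/2)⁻¹).toNNReal)
  refine ⟨N, fun k hk => ?_⟩
  rw [Real.dist_eq, sub_zero, abs_of_nonneg (lux_nonneg _ _)]
  exact (lux_le (half_pos hε) (hN k hk.le)).trans_lt (half_lt_self hε)

lemma NS_of_tendsto {E : Type*} [NormedAddCommGroup E] {p : ℝ → ℝ≥0∞}
    (hp : ∀ᵐ x ∂mu01, 1 ≤ p x) (hpm : Measurable p) {f g : ℝ → E} (hf : SBdd p Set.univ f)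
    (hg : SBdd p Set.univ g) {b : ℕ → ℝ} {t : ℝ}
    (h : Tendsto (fun k => luxNorm p (fun x => f (b k + x) - g (t + x))) atTop (𝓝 0)) :
    NS p (fun k x => ‖f (b k + x) - g (t + x)‖ₑ) := by
  intro c
  have hl : 0 < ((c:ℝ) + 1)⁻¹ := by positivity
  filter_upwards [h.eventually_lt_const hl] with k hk
  have hb : Bd p (fun (_ : Unit) x => ‖f (b k + x) - g (t + x)‖ₑ) := by
    refine (Bd.add hp hpm ((hf.bd hp).comp (fun _ : Unit => b k))
      ((hg.bd hp).comp (fun _ : Unit => t)) ?_).mono ?_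
    · intro _; exact (aesm_shift hf.aesm _).enorm
    · intro _; exact Eventually.of_forall fun x => enorm_sub_le
  obtain ⟨d, hd, hb⟩ := hb
  refine Rho_const_mono ?_ (lux_lt ⟨d, hd, hb ()⟩ hk)
  rw [inv_inv, ← ENNReal.ofReal_coe_nnreal]
  exact ENNReal.ofReal_le_ofReal (by simp)

lemma NS.lintegral {p : ℝ → ℝ≥0∞} (hp : ∀ᵐ x ∂mu01, 1 ≤ p x) {w : ℕ → ℝ → ℝ≥0∞}
    (h : NS p w) : Tendsto (fun k => ∫⁻ x, w k x ∂mu01) atTop (𝓝 0) := by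
  rw [ENNReal.tendsto_nhds_zero]
  intro ε hε
  obtain ⟨e, he, hee⟩ := ENNReal.lt_iff_exists_nnreal_btwn.1 hε
  have he0 : 0 < e := by exact_mod_cast he
  filter_upwards [h (2 / e)] with k hk
  have h1 := lintegral_le_of_Rho hp hk
  rw [lintegral_const_mul' _ _ ENNReal.coe_ne_top] at h1
  refine le_trans ?_ hee.le
  have e1 : (1 : ℝ≥0∞) = ((e/2 : NNReal) : ℝ≥0∞) * ((2/e : NNReal) : ℝ≥0∞) := by
    rw [← ENNReal.coe_mul]
    have : e / 2 * (2 / e) = 1 := by field_simp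
    rw [this]; simp
  calc ∫⁻ x, w k x ∂mu01 = ((e/2 : NNReal) : ℝ≥0∞) * (((2/e : NNReal) : ℝ≥0∞) * ∫⁻ x, w k x ∂mu01) := by
        rw [← mul_assoc, ← e1, one_mul]
    _ ≤ ((e/2 : NNReal) : ℝ≥0∞) * 2 := by gcongr
    _ = e := by
      rw [show (2:ℝ≥0∞) = ((2:NNReal) : ℝ≥0∞) by norm_num, ← ENNReal.coe_mul]
      congr 1; field_simp

lemma exists_ae_subseq {w : ℕ → ℕ → ℝ → ℝ≥0∞} (hm : ∀ i k, AEMeasurable (w i k) mu01)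
    (h : ∀ i, Tendsto (fun k => ∫⁻ x, w i k x ∂mu01) atTop (𝓝 0)) :
    ∃ n : ℕ → ℕ, StrictMono n ∧ ∀ i, ∀ᵐ x ∂mu01, Tendsto (fun j => w i (n j) x) atTop (𝓝 0) := by
  have : ∀ j : ℕ, ∀ᶠ k in atTop, ∀ i ∈ Finset.range (j+1), ∫⁻ x, w i k x ∂mu01 ≤ 2⁻¹ ^ j := by
    intro j
    rw [Filter.eventually_all_finset]
    intro i _
    exact ENNReal.tendsto_nhds_zero.1 (h i) _ (ENNReal.pow_pos (by simp) j)
  obtain ⟨n, hn, hP⟩ := extraction_forall_of_eventually this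
  refine ⟨n, hn, fun i => ?_⟩
  have h1 : ∫⁻ x, ∑' j, w i (n (j + i)) x ∂mu01 ≠ ∞ := by
    rw [lintegral_tsum (fun j => hm _ _)]
    refine ne_top_of_le_ne_top (b := ∑' j : ℕ, (2⁻¹ : ℝ≥0∞) ^ j) ?_ ?_
    · rw [ENNReal.tsum_geometric]; simp
    · refine ENNReal.tsum_le_tsum fun j => (hP (j + i) i (by simp)).trans ?_
      exact pow_le_pow_of_le_one zero_le (by simp) (by simp)
  have h2 := ae_lt_top' (AEMeasurable.tsum fun j => hm i (n (j + i))) h1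
  filter_upwards [h2] with x hx
  have := ENNReal.tendsto_atTop_zero_of_tsum_ne_top hx.ne
  exact (tendsto_add_atTop_iff_nat (f := fun j => w i (n j) x) i).1 this

lemma aesm_select {X : Type*} [NormedAddCommGroup X] {F : ℕ → ℝ → X} {n : ℝ → ℕ}
    (hF : ∀ i, AEStronglyMeasurable (F i) volume) (hn : AEMeasurable n volume) :
    AEStronglyMeasurable (fun s => F (n s) s) volume := by
  have h1 : StronglyMeasurable (Function.uncurry fun (i : ℕ) (s : ℝ) => (hF i).mk (F i) s) :=
    stronglyMeasurable_uncurry_of_continuous_of_stronglyMeasurable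
      (fun s => continuous_of_discreteTopology) (fun i => (hF i).stronglyMeasurable_mk)
  refine ⟨fun s => (hF (hn.mk n s)).mk (F (hn.mk n s)) s,
    h1.comp_measurable (hn.measurable_mk.prodMk measurable_id), ?_⟩
  filter_upwards [hn.ae_eq_mk, ae_all_iff.2 fun i => (hF i).ae_eq_mk] with s h2 h3
  rw [← h2]; exact h3 (n s)

/-- a function `H` that is obtained from `F` by substituting `w` -/
structure Good {X Y : Type*} [NormedAddCommGroup X] [NormedAddCommGroup Y]
    (p r : ℝ → ℝ≥0∞) (K : Set Y) (e : ℕ → Y)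
    (H : ℝ → X) (F : ℝ → Y → X) (w : ℝ → Y) (M : ℝ → ℝ≥0∞) : Prop where
  wK : ∀ᵐ s, w s ∈ K
  Mt : ∀ᵐ s, M s < ∞
  lip : ∀ᵐ s, ∀ i, ‖H s - F s (e i)‖ₑ ≤ M s * ‖w s - e i‖ₑ
  Mm : AEMeasurable M volume
  Mb : Bd r (fun t x => M (t + x))
  Fb : ∀ i, SBdd p Set.univ (fun t => F t (e i))
  wb : SBdd p Set.univ w

lemma Good.aesm {X Y : Type*} [NormedAddCommGroup X] [NormedAddCommGroup Y]
    {p r : ℝ → ℝ≥0∞} {K : Set Y} {e : ℕ → Y}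
    {H : ℝ → X} {F : ℝ → Y → X} {w : ℝ → Y} {M : ℝ → ℝ≥0∞} (g : Good p r K e H F w M)
    (hK : K ⊆ closure (range e)) : AEStronglyMeasurable H volume := by
  borelize Y
  refine aestronglyMeasurable_of_tendsto_ae atTop
    (f := fun j s => F s (e (SimpleFunc.nearestPtInd e j (w s)))) ?_ ?_
  · intro j
    exact aesm_select (F := fun i s => F s (e i)) (fun i => (g.Fb i).aesm)
      ((SimpleFunc.nearestPtInd e j).measurable.comp_aemeasurable g.wb.aesm.aemeasurable)
  · filter_upwards [g.wK, g.Mt, g.lip] with s h1 h2 h3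
    have h4 : Tendsto (fun j => e (SimpleFunc.nearestPtInd e j (w s))) atTop (𝓝 (w s)) :=
      SimpleFunc.tendsto_nearestPt (hK h1)
    rw [tendsto_iff_edist_tendsto_0] at h4 ⊢
    have h5 := ENNReal.Tendsto.const_mul (a := M s) h4 (Or.inr h2.ne)
    rw [mul_zero] at h5
    refine tendsto_of_tendsto_of_tendsto_of_le_of_le tendsto_const_nhds h5
      (fun _ => zero_le) fun j => ?_
    rw [edist_comm, edist_comm _ (w s), edist_eq_enorm_sub, edist_eq_enorm_sub]
    exact h3 _

lemma Good.sbdd {X Y : Type*} [NormedAddCommGroup X] [NormedAddCommGroup Y]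
    {p r q : ℝ → ℝ≥0∞} (h : Expo p r q) {K : Set Y} {e : ℕ → Y}
    {H : ℝ → X} {F : ℝ → Y → X} {w : ℝ → Y} {M : ℝ → ℝ≥0∞} (g : Good p r K e H F w M)
    (hK : K ⊆ closure (range e)) (hKc : IsCompact K) : SBdd q Set.univ H := by
  refine SBdd.of_bd (g.aesm hK) ?_
  obtain ⟨R, hR⟩ := hKc.isBounded.exists_norm_le
  have hR' : ∀ y ∈ K, ‖y - e 0‖ₑ ≤ ((R + ‖e 0‖).toNNReal : ℝ≥0∞) := by
    intro y hy
    rw [← ofReal_norm]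
    exact ENNReal.ofReal_le_ofReal ((norm_sub_le _ _).trans (by linarith [hR y hy]))
  have b1 := ((g.Mb.embed h.p1 h.pr).embed h.q1 h.qp).const_mul (R + ‖e 0‖).toNNReal
  have b2 := ((g.Fb 0).bd h.p1).embed h.q1 h.qp
  refine (b1.add h.q1 h.qm b2 fun t => (aem_shift g.Mm t).const_mul _).mono fun t => ?_
  filter_upwards [ae_shift g.wK t, ae_shift g.lip t] with x h1 h2
  calc ‖H (t + x)‖ₑ = ‖(H (t + x) - F (t + x) (e 0)) + F (t + x) (e 0)‖ₑ := by simp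
    _ ≤ ‖H (t + x) - F (t + x) (e 0)‖ₑ + ‖F (t + x) (e 0)‖ₑ := enorm_add_le _ _
    _ ≤ M (t + x) * ‖w (t + x) - e 0‖ₑ + ‖F (t + x) (e 0)‖ₑ := by gcongr; exact h2 0
    _ ≤ M (t + x) * ((R + ‖e 0‖).toNNReal : ℝ≥0∞) + ‖F (t + x) (e 0)‖ₑ := by
      gcongr; exact hR' _ h1
    _ = _ := by rw [mul_comm]

lemma cover {Y : Type*} [NormedAddCommGroup Y] {K : Set Y} {e : ℕ → Y}
    (hK : K ⊆ closure (range e)) (hKc : IsCompact K) {ε : NNReal} (hε : 0 < ε) :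
    ∃ m : Finset ℕ, ∀ y ∈ K, ∃ i ∈ m, ‖y - e i‖ₑ ≤ ε := by
  have hε' : (0:ℝ) < ε := by exact_mod_cast hε
  obtain ⟨m, hm⟩ := hKc.elim_finite_subcover (fun i => Metric.ball (e i) ε)
    (fun i => Metric.isOpen_ball) (fun y hy => by
      obtain ⟨_, ⟨i, rfl⟩, hi⟩ := Metric.mem_closure_iff.1 (hK hy) ε hε'
      exact mem_iUnion.2 ⟨i, hi⟩)
  refine ⟨m, fun y hy => ?_⟩
  obtain ⟨i, hi, hy⟩ := mem_iUnion₂.1 (hm hy)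
  refine ⟨i, hi, ?_⟩
  rw [Metric.mem_ball, dist_eq_norm] at hy
  rw [← ofReal_norm, ← ENNReal.ofReal_coe_nnreal]
  exact ENNReal.ofReal_le_ofReal hy.le

lemma Good.conv {X Y : Type*} [NormedAddCommGroup X] [NormedAddCommGroup Y]
    {p r q : ℝ → ℝ≥0∞} (h : Expo p r q) {K : Set Y} {e : ℕ → Y}
    {H H' : ℝ → X} {F F' : ℝ → Y → X} {w w' : ℝ → Y} {M M' : ℝ → ℝ≥0∞}
    (g : Good p r K e H F w M) (g' : Good p r K e H' F' w' M')
    (hK : K ⊆ closure (range e)) (hKc : IsCompact K) {b : ℕ → ℝ} {t : ℝ}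
    (hF : ∀ i, Tendsto (fun k => luxNorm p (fun x => F (b k + x) (e i) - F' (t + x) (e i)))
      atTop (𝓝 0))
    (hw : Tendsto (fun k => luxNorm p (fun x => w (b k + x) - w' (t + x))) atTop (𝓝 0)) :
    Tendsto (fun k => luxNorm q (fun x => H (b k + x) - H' (t + x))) atTop (𝓝 0) := by
  refine tendsto_lux ?_
  refine NS_core h (A := fun k x => M (b k + x) + M' (t + x))
    (d := fun k x => ‖w (b k + x) - w' (t + x)‖ₑ)
    (D := fun i k x => ‖F (b k + x) (e i) - F' (t + x) (e i)‖ₑ) ?_ ?_ ?_ ?_ ?_ ?_ ?_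
  · exact NS_of_tendsto h.p1 h.pm g.wb g'.wb hw
  · exact Bd.add h.r1 h.rm (g.Mb.comp b) (g'.Mb.comp fun _ => t) fun k => aem_shift g.Mm _
  · intro i
    exact NS_of_tendsto h.p1 h.pm (g.Fb i) (g'.Fb i) (hF i)
  · intro k; exact (aem_shift g.Mm _).add (aem_shift g'.Mm _)
  · intro k; exact ((aesm_shift g.wb.aesm _).sub (aesm_shift g'.wb.aesm _)).enorm
  · intro i k
    exact ((aesm_shift (g.Fb i).aesm _).sub (aesm_shift (g'.Fb i).aesm _)).enorm
  · intro ε hε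
    obtain ⟨m, hm⟩ := cover hK hKc hε
    refine ⟨m, fun k => ?_⟩
    filter_upwards [ae_shift g.lip (b k), ae_shift g'.lip t, ae_shift g'.wK t] with x h1 h2 h3
    obtain ⟨i, hi, hy⟩ := hm _ h3
    refine ⟨i, hi, ?_⟩
    have e1 : ‖w (b k + x) - e i‖ₑ ≤ ‖w (b k + x) - w' (t + x)‖ₑ + ε := by
      calc ‖w (b k + x) - e i‖ₑ = ‖(w (b k + x) - w' (t + x)) + (w' (t + x) - e i)‖ₑ := by simp
        _ ≤ _ := (enorm_add_le _ _).trans (by gcongr)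
    calc ‖H (b k + x) - H' (t + x)‖ₑ
        = ‖(H (b k + x) - F (b k + x) (e i)) - (H' (t + x) - F' (t + x) (e i))
            + (F (b k + x) (e i) - F' (t + x) (e i))‖ₑ := by congr 1; abel
      _ ≤ (‖H (b k + x) - F (b k + x) (e i)‖ₑ + ‖H' (t + x) - F' (t + x) (e i)‖ₑ)
            + ‖F (b k + x) (e i) - F' (t + x) (e i)‖ₑ :=
          (enorm_add_le _ _).trans (by gcongr; exact enorm_sub_le)
      _ ≤ (M (b k + x) * (‖w (b k + x) - w' (t + x)‖ₑ + ε)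
            + M' (t + x) * (‖w (b k + x) - w' (t + x)‖ₑ + ε))
            + ‖F (b k + x) (e i) - F' (t + x) (e i)‖ₑ := by
          gcongr
          · exact (h1 i).trans (by gcongr)
          · exact (h2 i).trans (by gcongr; exact hy.trans le_add_self)
      _ = _ := by rw [add_mul]

lemma Ph_liminf (P : ℝ≥0∞) (a : ℕ → ℝ≥0∞) (c : NNReal) :
    Ph P (c * liminf a atTop) ≤ liminf (fun k => Ph P (c * a k)) atTop := by
  by_cases hP : P = ∞
  · simp only [Ph, hP, ne_eq, not_true_eq_false, if_false]
    split_ifs with h1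
    · simp
    · have h2 : (c : ℝ≥0∞) * liminf a atTop = liminf (fun k => c * a k) atTop :=
        Monotone.map_liminf_of_continuousAt (f := fun t => (c : ℝ≥0∞) * t)
          (fun x y h => by dsimp only; gcongr) _ (ENNReal.continuous_const_mul ENNReal.coe_ne_top).continuousAt
      rw [h2, not_le] at h1
      have h3 := eventually_lt_of_lt_liminf h1
      refine le_of_eq (Eq.symm ?_)
      have : (fun k => if (c:ℝ≥0∞) * a k ≤ 1 then (0:ℝ≥0∞) else ∞) =ᶠ[atTop] fun _ => ∞ := by
        filter_upwards [h3] with k hk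
        simp [hk]
      rw [liminf_congr this]; simp
  · refine le_of_eq (Monotone.map_liminf_of_continuousAt (f := fun t => Ph P (c * t))
      (fun x y h => Ph_mono P (by gcongr)) _ ?_)
    simp only [Ph, ne_eq, hP, not_false_eq_true, if_true]
    exact (ENNReal.continuous_rpow_const.comp
      (ENNReal.continuous_const_mul ENNReal.coe_ne_top)).continuousAt

lemma Bd_liminf {r : ℝ → ℝ≥0∞} (hr : Measurable r) {L : ℝ → ℝ≥0∞} (hL : AEMeasurable L volume)
    (hb : Bd r (fun t x => L (t + x))) (b : ℕ → ℝ) :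
    Bd r (fun t x => liminf (fun k => L (b k + (t + x))) atTop) := by
  obtain ⟨c, hc, h⟩ := hb
  refine ⟨c, hc, fun t => ?_⟩
  calc _ ≤ ∫⁻ x, liminf (fun k => Ph (r x) (c * L (b k + (t + x)))) atTop ∂mu01 :=
        lintegral_mono fun x => Ph_liminf _ _ _
    _ ≤ liminf (fun k => ∫⁻ x, Ph (r x) (c * L (b k + (t + x))) ∂mu01) atTop := by
        refine lintegral_liminf_le' fun k => Ph_meas hr (AEMeasurable.const_mul ?_ _)
        simp only [← add_assoc]
        exact aem_shift hL _
    _ ≤ liminf (fun k : ℕ => (1:ℝ≥0∞)) atTop := by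
        refine liminf_le_liminf (Eventually.of_forall fun k => ?_)
        simp only [← add_assoc]
        exact h (b k + t)
    _ = 1 := by simp

lemma lim_le_liminf_mul {x L : ℕ → ℝ≥0∞} {y c : ℝ≥0∞} (hc : c ≠ ∞)
    (hx : Tendsto x atTop (𝓝 y)) (h : ∀ k, x k ≤ L k * c) : y ≤ liminf L atTop * c := by
  have h2 : liminf L atTop * c = liminf (fun k => L k * c) atTop :=
        Monotone.map_liminf_of_continuousAt (f := fun t => t * c)
          (fun x y h => by dsimp only; gcongr) _ (ENNReal.continuous_mul_const hc).continuousAt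
  rw [h2, ← hx.liminf_eq]
  exact liminf_le_liminf (Eventually.of_forall h)

lemma exists_ext {X Y : Type*} [NormedAddCommGroup X] [CompleteSpace X] [NormedAddCommGroup Y]
    {e : ℕ → Y} {G : Y → X} {M : ℝ≥0∞} (hM : M < ∞) {v : Y} (hv : v ∈ closure (range e))
    (hG : ∀ i j, ‖G (e i) - G (e j)‖ₑ ≤ M * ‖e i - e j‖ₑ) :
    ∃ x : X, ∀ i, ‖x - G (e i)‖ₑ ≤ M * ‖v - e i‖ₑ := by
  obtain ⟨z, hz, hzv⟩ := mem_closure_iff_seq_limit.1 hv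
  choose φ hφ using hz
  have hc : CauchySeq (fun k => G (e (φ k))) := by
    have h1 := hzv.cauchySeq
    rw [EMetric.cauchySeq_iff] at h1 ⊢
    intro ε hε
    lift M to NNReal using hM.ne
    obtain ⟨N, hN⟩ := h1 (ε / (M + 1)) (ENNReal.div_pos hε.ne' (by simp))
    refine ⟨N, fun m hm n hn => ?_⟩
    have := hN m hm n hn
    rw [← hφ, ← hφ, ENNReal.lt_div_iff_mul_lt (by simp) (by simp), mul_comm] at this
    refine lt_of_le_of_lt ?_ this
    rw [edist_eq_enorm_sub, edist_eq_enorm_sub]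
    exact (hG _ _).trans (by gcongr; simp)
  obtain ⟨x, hx⟩ := cauchySeq_tendsto_of_complete hc
  refine ⟨x, fun i => ?_⟩
  have h1 : Tendsto (fun k => ‖G (e (φ k)) - G (e i)‖ₑ) atTop (𝓝 ‖x - G (e i)‖ₑ) :=
    (hx.sub_const _).enorm
  have h2 : Tendsto (fun k => M * ‖e (φ k) - e i‖ₑ) atTop (𝓝 (M * ‖v - e i‖ₑ)) := by
    refine ENNReal.Tendsto.const_mul ?_ (Or.inr hM.ne)
    simp only [hφ]
    exact (hzv.sub_const _).enorm
  exact le_of_tendsto_of_tendsto' h1 h2 fun k => hG _ _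

lemma expo_pt {P R Q : ℝ≥0∞} (hP : 1 ≤ P) (hR : R ≠ ∞) (h1 : P ≤ R) (h2 : P / (P - 1) ≤ R)
    (hQ : Q = P * R / (P + R)) : 1 ≤ Q ∧ Q < P := by
  have hPt : P ≠ ∞ := ne_top_of_le_ne_top hR h1
  have hP0 : P ≠ 0 := (lt_of_lt_of_le one_pos hP).ne'
  have hS0 : P + R ≠ 0 := by simp [hP0]
  have hSt : P + R ≠ ∞ := by simp [hPt, hR]
  have hne : P - 1 ≠ 0 := by
    intro h
    rw [h, ENNReal.div_zero hP0] at h2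
    exact hR (top_le_iff.1 h2)
  have h3 : P ≤ R * (P - 1) :=
    (ENNReal.div_le_iff hne (ENNReal.sub_ne_top hPt)).1 h2
  subst hQ
  constructor
  · rw [ENNReal.le_div_iff_mul_le (Or.inl hS0) (Or.inl hSt), one_mul]
    calc P + R ≤ R * (P - 1) + R * 1 := by rw [mul_one]; gcongr
      _ = P * R := by rw [← mul_add, tsub_add_cancel_of_le hP, mul_comm]
  · rw [ENNReal.div_lt_iff (Or.inl hS0) (Or.inl hSt)]
    refine (ENNReal.mul_lt_mul_iff_right hP0 hPt).2 ?_
    rw [add_comm]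
    exact ENNReal.lt_add_right hR hP0

/-- composition principle with a Stepanov r(x)-Lipschitz coefficient;
the composition is Stepanov q(x)-almost automorphic with
q = p r/(p+r) where r < ∞, and q = p where r = ∞. -/
theorem stepanov_px_aa_composition_variable_lipschitz
    {X Y : Type*} [NormedAddCommGroup X] [NormedSpace ℂ X] [CompleteSpace X]
    [NormedAddCommGroup Y] [NormedSpace ℂ Y] [CompleteSpace Y]
    (p r q : ℝ → ℝ≥0∞) (hpmeas : Measurable p) (hrmeas : Measurable r)
    (hp1 : ∀ x ∈ Set.Icc (0:ℝ) 1, 1 ≤ p x) (hr1 : ∀ x ∈ Set.Icc (0:ℝ) 1, 1 ≤ r x)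
    (hrmax : ∀ᵐ x ∂(MeasureTheory.volume.restrict (Set.Icc (0:ℝ) 1)),
      p x ≤ r x ∧ p x / (p x - 1) ≤ r x)
    (hqdef : ∀ x : ℝ, (r x ≠ ∞ → q x = p x * r x / (p x + r x)) ∧ (r x = ∞ → q x = p x))
    (f : ℝ → Y → X) (hf : AAS2Var p f)
    (Lf : ℝ → ℝ) (hLf0 : ∀ t : ℝ, 0 ≤ Lf t) (hLfS : SBdd r Set.univ Lf)
    (hLip : ∀ (t : ℝ) (y₁ y₂ : Y), ‖f t y₁ - f t y₂‖ ≤ Lf t * ‖y₁ - y₂‖)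
    (u : ℝ → Y) (hu : AASVar p u)
    (E : Set ℝ) (hE : MeasureTheory.volume E = 0)
    (hK : IsCompact (closure (u '' (Set.univ \ E)))) :
    (∀ᵐ x ∂(MeasureTheory.volume.restrict (Set.Icc (0:ℝ) 1)),
      r x ≠ ∞ → 1 ≤ q x ∧ q x < p x) ∧
    AASVar q (fun t => f t (u t)) := by
  have hp1' : ∀ᵐ x ∂mu01, 1 ≤ p x := (ae_restrict_iff' measurableSet_Icc).2 (Eventually.of_forall hp1)
  have hr1' : ∀ᵐ x ∂mu01, 1 ≤ r x := (ae_restrict_iff' measurableSet_Icc).2 (Eventually.of_forall hr1)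
  have hfirst : ∀ᵐ x ∂mu01, r x ≠ ∞ → 1 ≤ q x ∧ q x < p x := by
    filter_upwards [hp1', hrmax] with x h1 h2 h3
    exact expo_pt h1 h3 h2.1 h2.2 ((hqdef x).1 h3)
  refine ⟨hfirst, ?_⟩
  have hq : q = fun x => if r x = ∞ then p x else p x * r x / (p x + r x) := by
    ext x
    split_ifs with hx
    · exact (hqdef x).2 hx
    · exact (hqdef x).1 hx
  have hX : Expo p r q := by
    refine ⟨hpmeas, hrmeas, ?_, hp1', hr1', ?_, ?_, ?_, hqdef⟩
    · rw [hq]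
      exact Measurable.ite (hrmeas (measurableSet_singleton _)) hpmeas
        ((hpmeas.mul hrmeas).div (hpmeas.add hrmeas))
    · filter_upwards [hfirst, hp1'] with x h1 h2
      by_cases hx : r x = ∞
      · rw [(hqdef x).2 hx]; exact h2
      · exact (h1 hx).1
    · filter_upwards [hrmax] with x h1 using h1.1
    · filter_upwards [hfirst] with x h1
      by_cases hx : r x = ∞
      · rw [(hqdef x).2 hx]
      · exact (h1 hx).2.le
  set K := closure (u '' (Set.univ \ E)) with hKdef
  have huK : ∀ᵐ s, u s ∈ K := by
    filter_upwards [measure_eq_zero_iff_ae_notMem.1 hE] with s hs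
    exact subset_closure ⟨s, ⟨mem_univ s, hs⟩, rfl⟩
  obtain ⟨e, heK⟩ : ∃ e : ℕ → Y, K ⊆ closure (range e) := by
    obtain ⟨c, hc, hcK⟩ := hK.isSeparable
    obtain ⟨s, hs⟩ := huK.exists
    have hne : c.Nonempty := closure_nonempty_iff.1 ⟨_, hcK hs⟩
    obtain ⟨e, rfl⟩ := hc.exists_eq_range hne
    exact ⟨e, hcK⟩
  have hLm : AEMeasurable (fun s => ‖Lf s‖ₑ) volume := hLfS.aesm.enorm
  have hLb : Bd r (fun t x => ‖Lf (t + x)‖ₑ) := hLfS.bd hr1'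
  have hLip' : ∀ (t : ℝ) (y₁ y₂ : Y), ‖f t y₁ - f t y₂‖ₑ ≤ ‖Lf t‖ₑ * ‖y₁ - y₂‖ₑ := by
    intro t y₁ y₂
    have := ENNReal.ofReal_le_ofReal (hLip t y₁ y₂)
    rwa [ENNReal.ofReal_mul (hLf0 t), ofReal_norm, ofReal_norm,
      ← Real.enorm_of_nonneg (hLf0 t)] at this
  have good : Good p r K e (fun t => f t (u t)) f u (fun s => ‖Lf s‖ₑ) :=
    { wK := huK
      Mt := Eventually.of_forall fun s => enorm_lt_top
      lip := Eventually.of_forall fun s i => hLip' _ _ _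
      Mm := hLm
      Mb := hLb
      Fb := fun i => hf.1 (e i)
      wb := hu.1 }
  refine ⟨good.sbdd hX heK hK, fun a => ?_⟩
  obtain ⟨n1, hn1, g, hgb, hg⟩ := hf.2 a
  obtain ⟨n2, hn2, v, hvb, hv⟩ := hu.2 (a ∘ n1)
  -- pointwise a.e. convergent subsequence
  let b : ℕ → ℝ := fun k => a (n1 (n2 k))
  have hgb' : ∀ (t : ℝ) (y : Y),
      Tendsto (fun k => luxNorm p (fun x => f (b k + t + x) y - g (t + x) y)) atTop (𝓝 0) := by
    intro t y
    have := (hg t y).1.comp hn2.tendsto_atTop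
    refine this.congr fun k => ?_
    simp only [Function.comp, b, add_comm t]
  let W : Option ℕ → ℤ → ℕ → ℝ → ℝ≥0∞ := fun o m k x => match o with
    | none => ‖u (b k + m + x) - v (m + x)‖ₑ
    | some i => ‖f (b k + m + x) (e i) - g (m + x) (e i)‖ₑ
  obtain ⟨en, hen⟩ := exists_surjective_nat (Option ℕ × ℤ)
  have hWm : ∀ o m k, AEMeasurable (W o m k) mu01 := by
    rintro (_ | i) m k
    · exact ((aesm_shift hu.1.aesm _).sub (aesm_shift hvb.aesm _)).enorm
    · exact ((aesm_shift (hf.1 (e i)).aesm _).sub (aesm_shift (hgb (e i)).aesm _)).enorm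
  have hWt : ∀ o m, Tendsto (fun k => ∫⁻ x, W o m k x ∂mu01) atTop (𝓝 0) := by
    rintro (_ | i) m
    · exact NS.lintegral hp1' (NS_of_tendsto hp1' hpmeas hu.1 hvb (b := fun k => b k + m)
        (t := m) (hv m).1)
    · exact NS.lintegral hp1' (NS_of_tendsto hp1' hpmeas (hf.1 (e i)) (hgb (e i))
        (b := fun k => b k + m) (t := m) (hgb' m (e i)))
  obtain ⟨n3, hn3, hae⟩ := exists_ae_subseq (w := fun j k => W (en j).1 (en j).2 k)
    (fun j k => hWm _ _ _) (fun j => hWt _ _)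
  have hae' : ∀ o m, ∀ᵐ x ∂mu01, Tendsto (fun j => W o m (n3 j) x) atTop (𝓝 0) := by
    intro o m
    obtain ⟨j, hj⟩ := hen (o, m)
    have := hae j
    rwa [hj] at this
  let c : ℕ → ℝ := fun k => b (n3 k)
  have hfg : ∀ᵐ s, ∀ i, Tendsto (fun k => f (c k + s) (e i)) atTop (𝓝 (g s (e i))) := by
    rw [ae_all_iff]
    intro i
    refine ae_of_shift fun m => ?_
    filter_upwards [hae' (some i) m] with x hx
    rw [tendsto_iff_edist_tendsto_0]
    refine hx.congr fun k => ?_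
    simp only [W, c, edist_eq_enorm_sub, add_assoc]
  have huv : ∀ᵐ s, Tendsto (fun k => u (c k + s)) atTop (𝓝 (v s)) := by
    refine ae_of_shift fun m => ?_
    filter_upwards [hae' none m] with x hx
    rw [tendsto_iff_edist_tendsto_0]
    refine hx.congr fun k => ?_
    simp only [W, c, edist_eq_enorm_sub, add_assoc]
  have hvK : ∀ᵐ s, v s ∈ K := by
    have : ∀ᵐ s, ∀ k, u (c k + s) ∈ K := by
      rw [ae_all_iff]; intro k
      filter_upwards [ae_shift' huK (c k)] with s hs
      rwa [add_comm]
    filter_upwards [this, huv] with s h1 h2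
    exact isClosed_closure.mem_of_tendsto h2 (Eventually.of_forall h1)
  let M : ℝ → ℝ≥0∞ := fun s => liminf (fun k => ‖Lf (c k + s)‖ₑ) atTop
  have hMb : Bd r (fun t x => M (t + x)) := Bd_liminf hrmeas hLm hLb c
  have hMm : AEMeasurable M volume := by
    have hk : ∀ k, AEMeasurable (fun s => ‖Lf (c k + s)‖ₑ) volume := fun k =>
      hLm.comp_quasiMeasurePreserving
        (measurePreserving_add_left (volume : Measure ℝ) (c k)).quasiMeasurePreserving
    refine ⟨fun s => liminf (fun k => (hk k).mk _ s) atTop,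
      Measurable.liminf fun k => (hk k).measurable_mk, ?_⟩
    filter_upwards [ae_all_iff.2 fun k => (hk k).ae_eq_mk] with s hs
    simp only [M]
    congr 1; ext k; exact hs k
  have hMt : ∀ᵐ s, M s < ∞ := by
    refine ae_of_shift fun m => ?_
    obtain ⟨d, hd, hMd⟩ := hMb
    have h1 := lintegral_le_of_Rho hr1' (hMd m)
    have h2 := ae_lt_top' ((aem_shift hMm m).const_mul (d : ℝ≥0∞))
      (ne_top_of_le_ne_top (by simp) h1)
    filter_upwards [h2] with x hx
    by_contra h
    rw [not_lt_top_iff] at h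
    rw [h, ENNReal.mul_top (by exact_mod_cast hd.ne')] at hx
    exact lt_irrefl _ hx
  have hH : ∀ᵐ s, ∃ x : X, ∀ i, ‖x - g s (e i)‖ₑ ≤ M s * ‖v s - e i‖ₑ := by
    filter_upwards [hMt, hvK, hfg] with s h1 h2 h3
    refine exists_ext h1 (heK h2) fun i j => ?_
    exact lim_le_liminf_mul enorm_ne_top ((h3 i).sub (h3 j)).enorm fun k => hLip' _ _ _
  obtain ⟨H, hH⟩ : ∃ H : ℝ → X, ∀ᵐ s, ∀ i, ‖H s - g s (e i)‖ₑ ≤ M s * ‖v s - e i‖ₑ := by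
    classical
    refine ⟨fun s => if h : ∃ x : X, ∀ i, ‖x - g s (e i)‖ₑ ≤ M s * ‖v s - e i‖ₑ then h.choose
      else 0, ?_⟩
    filter_upwards [hH] with s hs
    rw [dif_pos hs]
    exact hs.choose_spec
  have good' : Good p r K e H g v M :=
    { wK := hvK
      Mt := hMt
      lip := hH
      Mm := hMm
      Mb := hMb
      Fb := fun i => hgb (e i)
      wb := hvb }
  refine ⟨fun k => n1 (n2 (n3 k)), hn1.comp (hn2.comp hn3), H, good'.sbdd hX heK hK, fun t => ⟨?_, ?_⟩⟩
  · exact good.conv hX good' heK hK (b := fun k => c k + t) (t := t)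
      (fun i => (hgb' t (e i)).comp hn3.tendsto_atTop) ((hv t).1.comp hn3.tendsto_atTop)
  · exact good'.conv hX good heK hK (b := fun k => t - c k) (t := t)
      (fun i => (hg t (e i)).2.comp (hn2.comp hn3).tendsto_atTop)
      ((hv t).2.comp hn3.tendsto_atTop)

end
end

section
/- Let p : [0,1] → [1,∞) be Lebesgue measurable with 1 ≤ ess inf p ≤ p(x) ≤ ess sup p < ∞ a.e., let q : [0,1] → [1,∞] satisfy 1/p(x) + 1/q(x) = 1 for a.e. x ∈ [0,1], and let (R(t))_{t>0} be a family of bounded linear operators X → Y between complex Banach spaces that is strongly continuous on (0,∞) and satisfies M := Σ_{k=0}^{∞} ‖ ‖R(·+k)‖_{L(X,Y)} ‖_{L^{q(x)}[0,1]} < ∞ (the inner norm being the operator norm, the outer one the Luxemburg norm of the scalar function x ↦ ‖R(x+k)‖ on [0,1]). Let g : ℝ → X be such that the reflected function ǧ(t) := g(−t) is Stepanov p(x)-almost automorphic. Then for every t ∈ ℝ the integral G(t) := ∫_{−∞}^{t} R(t−s) g(s) ds converges absolutely, and the function G : ℝ → Y is almost automorphic. -/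
open MeasureTheory Filter Topology Set
open scoped ENNReal

noncomputable section

lemma phi_mono (p : ℝ → ℝ≥0∞) (x : ℝ) {s t : ℝ} (hs : 0 ≤ s) (hst : s ≤ t) :
    phiVar p x s ≤ phiVar p x t := by
  unfold phiVar
  split_ifs with h1 h2 h3 h4
  · exact ENNReal.ofReal_le_ofReal (Real.rpow_le_rpow hs hst ENNReal.toReal_nonneg)
  · exact le_rfl
  · exact bot_le
  · exact absurd (hst.trans h4) h2
  · exact le_rfl

lemma phi_scale (p : ℝ → ℝ≥0∞) (x : ℝ) {c t : ℝ} (hp : 1 ≤ p x) (hc : 0 < c) (hc1 : c ≤ 1)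
    (ht : 0 ≤ t) : phiVar p x (c * t) ≤ ENNReal.ofReal c * phiVar p x t := by
  unfold phiVar
  split_ifs with h1 h2 h3 h4
  · rw [← ENNReal.ofReal_mul hc.le, Real.mul_rpow hc.le ht]
    apply ENNReal.ofReal_le_ofReal
    have h : (1:ℝ) ≤ (p x).toReal := by
      have := ENNReal.toReal_mono h1 hp
      simpa using this
    exact mul_le_mul_of_nonneg_right
      (Real.rpow_le_self_of_le_one hc.le hc1 h) (Real.rpow_nonneg ht _)
  · simp
  · simp
  · nlinarith
  · rw [ENNReal.mul_top (by simpa using hc)]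

lemma phi_young (p q : ℝ → ℝ≥0∞) (x : ℝ) {s t : ℝ} (hp : p x ≠ ∞)
    (hc : 1 / p x + 1 / q x = 1)
    (hs : 0 ≤ s) (ht : 0 ≤ t) : ENNReal.ofReal (s * t) ≤ phiVar q x s + phiVar p x t := by
  by_cases hq : q x = ∞
  · have hp2 : p x = 1 := by
      simpa [hq] using hc
    unfold phiVar
    simp only [hq, hp2, ne_eq, not_true_eq_false, if_false, ENNReal.one_ne_top, not_false_eq_true,
      if_true, ENNReal.toReal_one, Real.rpow_one]
    split_ifs with h
    · rw [zero_add]; exact ENNReal.ofReal_le_ofReal (by nlinarith)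
    · simp
  · have hq0 : q x ≠ 0 := by
      intro h; simp [h] at hc
    have hp0 : p x ≠ 0 := by
      intro h; simp [h] at hc
    have hpr : 0 < (p x).toReal := ENNReal.toReal_pos hp0 hp
    have hqr : 0 < (q x).toReal := ENNReal.toReal_pos hq0 hq
    have hcr : (p x).toReal⁻¹ + (q x).toReal⁻¹ = 1 := by
      have := congrArg ENNReal.toReal hc
      rw [ENNReal.toReal_add (by simp [hp0]) (by simp [hq0])] at this
      simpa using this
    have hh : (p x).toReal.HolderConjugate (q x).toReal := by
      rw [Real.holderConjugate_iff]
      refine ⟨?_, hcr⟩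
      have : 0 < (q x).toReal⁻¹ := by positivity
      by_contra hle
      push Not at hle
      have := (one_le_inv₀ hpr).2 hle
      linarith
    unfold phiVar
    rw [if_pos hq, if_pos hp, ← ENNReal.ofReal_add (by positivity) (by positivity)]
    apply ENNReal.ofReal_le_ofReal
    refine (Real.young_inequality_of_nonneg hs ht hh.symm).trans ?_
    have h1 := hh.lt.le
    have h2 := hh.symm.lt.le
    gcongr
    · exact div_le_self (by positivity) h2
    · exact div_le_self (by positivity) h1

lemma phi_meas (p : ℝ → ℝ≥0∞) (hp : Measurable p) {μ : Measure ℝ} {u : ℝ → ℝ}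
    (hu : AEMeasurable u μ) : AEMeasurable (fun x => phiVar p x (u x)) μ := by
  have : Measurable (fun z : ℝ × ℝ => phiVar p z.1 z.2) := by
    unfold phiVar
    refine Measurable.ite ?_ ?_ (Measurable.ite ?_ measurable_const measurable_const)
    · exact (measurableSet_eq_fun (hp.comp measurable_fst) measurable_const).compl
    · exact (measurable_snd.pow (hp.comp measurable_fst).ennreal_toReal).ennreal_ofReal
    · exact measurableSet_le measurable_snd measurable_const
  exact this.comp_aemeasurable (aemeasurable_id.prodMk hu)

lemma lux_nonempty {E : Type*} [NormedAddCommGroup E] (p : ℝ → ℝ≥0∞) 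
    (hp1 : ∀ᵐ x ∂(volume.restrict (Icc (0:ℝ) 1)), 1 ≤ p x) {f : ℝ → E} (hf : MemLpVar p f) :
    {lam : ℝ | 0 < lam ∧ rhoVar p (fun x => ‖f x‖ / lam) ≤ 1}.Nonempty := by
  obtain ⟨-, c, hc, hr⟩ := hf
  set r := (rhoVar p (fun x => c * ‖f x‖)).toReal with hrdef
  have hr0 : 0 ≤ r := ENNReal.toReal_nonneg
  refine ⟨(1 + r) / c, by positivity, ?_⟩
  have key : rhoVar p (fun x => ‖f x‖ / ((1 + r) / c)) ≤
      ENNReal.ofReal (1 / (1 + r)) * rhoVar p (fun x => c * ‖f x‖) := by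
    unfold rhoVar
    rw [← lintegral_const_mul' _ _ ENNReal.ofReal_ne_top]
    apply lintegral_mono_ae
    filter_upwards [hp1] with x hx
    have := phi_scale p x (c := 1 / (1 + r)) (t := c * ‖f x‖) hx (by positivity)
      (by rw [div_le_one (by positivity)]; linarith) (by positivity)
    convert this using 2
    field_simp
  refine key.trans ?_
  rw [← ENNReal.ofReal_toReal hr.ne, ← hrdef, ← ENNReal.ofReal_mul (by positivity)]
  rw [ENNReal.ofReal_le_one, one_div, inv_mul_le_iff₀ (by positivity)]
  linarith

lemma rho_le_one {E : Type*} [NormedAddCommGroup E] (p : ℝ → ℝ≥0∞) 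
    (hp1 : ∀ᵐ x ∂(volume.restrict (Icc (0:ℝ) 1)), 1 ≤ p x) {f : ℝ → E} (hf : MemLpVar p f)
    {lam : ℝ} (hl : luxNorm p f < lam) : rhoVar p (fun x => ‖f x‖ / lam) ≤ 1 := by
  obtain ⟨l, ⟨hl0, hl1⟩, hll⟩ := exists_lt_of_csInf_lt (lux_nonempty p hp1 hf) hl
  refine le_trans (lintegral_mono fun x => phi_mono p x ?_ ?_) hl1
  · have := hl0.trans hll
    positivity
  · exact div_le_div_of_nonneg_left (norm_nonneg _) hl0 hll.le

lemma MemLpVar_sub {E : Type*} [NormedAddCommGroup E] (p : ℝ → ℝ≥0∞) (hp : Measurable p)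
    {f h : ℝ → E} (hf : MemLpVar p f) (hh : MemLpVar p h) : MemLpVar p (fun x => f x - h x) := by
  obtain ⟨mf, c, hc, hr⟩ := hf
  obtain ⟨mh, d, hd, hs⟩ := hh
  refine ⟨mf.sub mh, min c d / 2, by positivity, ?_⟩
  refine lt_of_le_of_lt ?_ (ENNReal.add_lt_top.2 ⟨hr, hs⟩)
  unfold rhoVar
  rw [← lintegral_add_left' (phi_meas p hp (mf.norm.aemeasurable.const_mul c))]
  apply lintegral_mono
  intro x
  have h0 : ‖f x - h x‖ ≤ ‖f x‖ + ‖h x‖ := norm_sub_le _ _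
  have hm1 : min c d * ‖f x‖ ≤ c * ‖f x‖ := by gcongr; exact min_le_left _ _
  have hm2 : min c d * ‖h x‖ ≤ d * ‖h x‖ := by gcongr; exact min_le_right _ _
  have hm0 : 0 < min c d := by positivity
  have hm3 : min c d * ‖f x - h x‖ ≤ min c d * (‖f x‖ + ‖h x‖) := by gcongr
  rcases le_total (c * ‖f x‖) (d * ‖h x‖) with hle | hle
  · refine le_trans (phi_mono p x (by positivity) ?_) le_add_self
    linarith
  · refine le_trans (phi_mono p x (by positivity) ?_) le_self_add
    linarith

lemma holder_var {E F : Type*} [NormedAddCommGroup E] [NormedAddCommGroup F]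
    (p q : ℝ → ℝ≥0∞) (hp : Measurable p)
    (hp1 : ∀ᵐ x ∂(volume.restrict (Icc (0:ℝ) 1)), 1 ≤ p x)
    (hpt : ∀ᵐ x ∂(volume.restrict (Icc (0:ℝ) 1)), p x ≠ ∞)
    (hc : ∀ᵐ x ∂(volume.restrict (Icc (0:ℝ) 1)), 1 / p x + 1 / q x = 1)
    {a : ℝ → F} {u : ℝ → E} (ha : MemLpVar q a) (hu : MemLpVar p u) :
    ∫⁻ x in Icc (0:ℝ) 1, ENNReal.ofReal (‖a x‖ * ‖u x‖) ≤
      ENNReal.ofReal (2 * luxNorm q a * luxNorm p u) := by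
  have hq1 : ∀ᵐ x ∂(volume.restrict (Icc (0:ℝ) 1)), 1 ≤ q x := by
    filter_upwards [hc] with x hx
    have : 1 / q x ≤ 1 := le_of_le_of_eq le_add_self hx
    simpa using this
  have key : ∀ ε : ℝ, 0 < ε → ∫⁻ x in Icc (0:ℝ) 1, ENNReal.ofReal (‖a x‖ * ‖u x‖) ≤
      ENNReal.ofReal (2 * (luxNorm q a + ε) * (luxNorm p u + ε)) := by
    intro ε hε
    have h1 := rho_le_one q hq1 ha (lt_add_of_pos_right _ hε)
    have h2 := rho_le_one p hp1 hu (lt_add_of_pos_right _ hε)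
    have hA := lux_nonneg q a
    have hB := lux_nonneg p u
    set A := luxNorm q a + ε with hAd
    set B := luxNorm p u + ε
    have hA : 0 < A := by positivity
    have hB : 0 < B := by positivity
    calc ∫⁻ x in Icc (0:ℝ) 1, ENNReal.ofReal (‖a x‖ * ‖u x‖) 
        ≤ ∫⁻ x in Icc (0:ℝ) 1, ENNReal.ofReal (A * B) *
          (phiVar q x (‖a x‖ / A) + phiVar p x (‖u x‖ / B)) := by
          apply lintegral_mono_ae
          filter_upwards [hpt, hc] with x hx2 hx3
          have := phi_young p q x (s := ‖a x‖ / A) (t := ‖u x‖ / B) hx2 hx3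
            (by positivity) (by positivity)
          calc _ = ENNReal.ofReal (A * B) * ENNReal.ofReal ((‖a x‖ / A) * (‖u x‖ / B)) := by
                rw [← ENNReal.ofReal_mul (by positivity)]
                congr 1
                field_simp
            _ ≤ _ := by gcongr
      _ = ENNReal.ofReal (A * B) * (rhoVar q (fun x => ‖a x‖ / A) + rhoVar p (fun x => ‖u x‖ / B)) := by
          rw [lintegral_const_mul' _ _ ENNReal.ofReal_ne_top, lintegral_add_right']
          · rfl
          · exact phi_meas p hp (hu.1.norm.aemeasurable.div_const B)
      _ ≤ ENNReal.ofReal (A * B) * (1 + 1) := by gcongr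
      _ = ENNReal.ofReal (2 * A * B) := by
          rw [mul_assoc, ENNReal.ofReal_mul (by norm_num : (0:ℝ) ≤ 2), mul_comm]
          norm_num [one_add_one_eq_two]
  have ht : Tendsto (fun ε : ℝ => ENNReal.ofReal (2 * (luxNorm q a + ε) * (luxNorm p u + ε)))
      (𝓝[>] 0) (𝓝 (ENNReal.ofReal (2 * luxNorm q a * luxNorm p u))) := by
    have hcn : Continuous (fun ε : ℝ => ENNReal.ofReal (2 * (luxNorm q a + ε) * (luxNorm p u + ε))) := by
      exact ENNReal.continuous_ofReal.comp (by fun_prop)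
    have := hcn.tendsto 0
    simp only [add_zero] at this
    exact this.mono_left nhdsWithin_le_nhds
  refine ge_of_tendsto ht ?_
  filter_upwards [self_mem_nhdsWithin] with ε hε using key ε hε

lemma mp_shift (τ : ℝ) : MeasurePreserving (fun x => τ + x)
    (volume.restrict (Icc (0:ℝ) 1)) (volume.restrict (Icc τ (τ + 1))) := by
  have := (measurePreserving_add_left (volume : Measure ℝ) τ).restrict_preimage_emb
    (measurableEmbedding_addLeft τ) (Icc τ (τ + 1))
  convert this using 2
  ext x
  simp

lemma lint_shift (τ : ℝ) (F : ℝ → ℝ≥0∞) :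
    ∫⁻ r in Icc τ (τ + 1), F r = ∫⁻ x in Icc (0:ℝ) 1, F (τ + x) :=
  ((mp_shift τ).lintegral_comp_emb (measurableEmbedding_addLeft τ) F).symm

lemma glob_aesm {E : Type*} [NormedAddCommGroup E] {w : ℝ → E}
    (h : ∀ τ : ℝ, AEStronglyMeasurable (fun x => w (τ + x)) (volume.restrict (Icc (0:ℝ) 1))) :
    AEStronglyMeasurable w volume := by
  rw [← Measure.restrict_univ (μ := (volume : Measure ℝ))]
  have : (univ : Set ℝ) = ⋃ n : ℤ, Icc (n:ℝ) (n + 1) := by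
    symm
    rw [eq_univ_iff_forall]
    intro x
    exact mem_iUnion.2 ⟨⌊x⌋, Int.floor_le x, (Int.lt_floor_add_one x).le⟩
  rw [this, aestronglyMeasurable_iUnion_iff]
  intro n
  exact ((mp_shift (n:ℝ)).aestronglyMeasurable_comp_iff (measurableEmbedding_addLeft _)).1 (h n)

lemma aesm_R {X Y : Type*} [NormedAddCommGroup X] [NormedSpace ℂ X]
    [NormedAddCommGroup Y] [NormedSpace ℂ Y]
    (R : ℝ → X →L[ℂ] Y) (hRc : ∀ v : X, ContinuousOn (fun t => R t v) (Set.Ioi 0))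
    {w : ℝ → X} (hw : AEStronglyMeasurable w (volume.restrict (Ioi 0))) :
    AEStronglyMeasurable (fun r => R r (w r)) (volume.restrict (Ioi 0)) := by
  have hs : ∀ s : SimpleFunc ℝ X,
      AEStronglyMeasurable (fun r => R r (s r)) (volume.restrict (Ioi 0)) := by
    intro s
    induction s using SimpleFunc.induction with
    | const c hS =>
      rename_i S
      have h1 : AEStronglyMeasurable (fun r => R r c) (volume.restrict (Ioi 0)) :=
        (hRc c).aestronglyMeasurable measurableSet_Ioi
      have h2 := h1.indicator hS
      refine h2.congr (Eventually.of_forall fun r => ?_)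
      by_cases hr : r ∈ S <;> simp [hr, SimpleFunc.piecewise_apply]
    | add _ hf hg =>
      simp only [SimpleFunc.coe_add, Pi.add_apply, map_add]
      exact hf.add hg
  obtain ⟨w', hw', hae⟩ := hw
  have h1 : AEStronglyMeasurable (fun r => R r (w' r)) (volume.restrict (Ioi 0)) :=
    aestronglyMeasurable_of_tendsto_ae atTop (fun n => hs (hw'.approx n))
      (Eventually.of_forall fun r => ((R r).continuous.tendsto _).comp (hw'.tendsto_approx r))
  refine h1.congr ?_
  filter_upwards [hae] with r hr
  rw [hr]

lemma lint_Ioi_le (F : ℝ → ℝ≥0∞) :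
    ∫⁻ r in Ioi (0:ℝ), F r ≤ ∑' k : ℕ, ∫⁻ x in Icc (0:ℝ) 1, F (k + x) := by
  have : Ioi (0:ℝ) ⊆ ⋃ k : ℕ, Icc (k:ℝ) (k + 1) := by
    intro x hx
    exact mem_iUnion.2 ⟨⌊x⌋₊, Nat.floor_le (le_of_lt hx), (Nat.lt_floor_add_one x).le⟩
  refine (lintegral_mono_set this).trans ((lintegral_iUnion_le _ _).trans ?_)
  exact le_of_eq (tsum_congr fun k => lint_shift _ _)

section conv
variable {X Y : Type*} [NormedAddCommGroup X] [NormedSpace ℂ X]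
  [NormedAddCommGroup Y] [NormedSpace ℂ Y]

lemma conv_bound (p q : ℝ → ℝ≥0∞) (hp : Measurable p)
    (hp1 : ∀ᵐ x ∂(volume.restrict (Icc (0:ℝ) 1)), 1 ≤ p x)
    (hpt : ∀ᵐ x ∂(volume.restrict (Icc (0:ℝ) 1)), p x ≠ ∞)
    (hc : ∀ᵐ x ∂(volume.restrict (Icc (0:ℝ) 1)), 1 / p x + 1 / q x = 1)
    (R : ℝ → X →L[ℂ] Y)
    (hRmem : ∀ k : ℕ, MemLpVar q (fun x => ‖R (x + (k : ℝ))‖))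
    {w : ℝ → X} (k : ℕ) (hw : MemLpVar p (fun x => w (k + x))) :
    ∫⁻ x in Icc (0:ℝ) 1, ‖R (k + x) (w (k + x))‖ₑ ≤
      ENNReal.ofReal (2 * luxNorm q (fun x => ‖R (x + (k : ℝ))‖) *
        luxNorm p (fun x => w (k + x))) := by
  refine le_trans (lintegral_mono fun x => ?_) (holder_var p q hp hp1 hpt hc (hRmem k) hw)
  rw [← ofReal_norm]
  apply ENNReal.ofReal_le_ofReal
  rw [norm_norm, add_comm x (k:ℝ)]
  exact (R _).le_opNorm _

lemma conv_integrable (p q : ℝ → ℝ≥0∞) (hp : Measurable p)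
    (hp1 : ∀ᵐ x ∂(volume.restrict (Icc (0:ℝ) 1)), 1 ≤ p x)
    (hpt : ∀ᵐ x ∂(volume.restrict (Icc (0:ℝ) 1)), p x ≠ ∞)
    (hc : ∀ᵐ x ∂(volume.restrict (Icc (0:ℝ) 1)), 1 / p x + 1 / q x = 1)
    (R : ℝ → X →L[ℂ] Y)
    (hRc : ∀ v : X, ContinuousOn (fun t => R t v) (Set.Ioi 0))
    (hRmem : ∀ k : ℕ, MemLpVar q (fun x => ‖R (x + (k : ℝ))‖))
    (hRsum : Summable (fun k : ℕ => luxNorm q (fun x => ‖R (x + (k : ℝ))‖)))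
    {w : ℝ → X} (hw : ∀ τ : ℝ, MemLpVar p (fun x => w (τ + x))) {C : ℝ}
    (hC : ∀ τ : ℝ, luxNorm p (fun x => w (τ + x)) ≤ C) :
    IntegrableOn (fun r => R r (w r)) (Ioi 0) := by
  refine ⟨aesm_R R hRc (glob_aesm fun τ => (hw τ).1).restrict, ?_⟩
  refine lt_of_le_of_lt (lint_Ioi_le _) ?_
  have hs : Summable (fun k : ℕ => 2 * luxNorm q (fun x => ‖R (x + (k : ℝ))‖) * C) :=
    (hRsum.mul_left 2).mul_right C
  refine lt_of_le_of_lt (ENNReal.tsum_le_tsum fun k => ?_) hs.tsum_ofReal_lt_top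
  refine (conv_bound p q hp hp1 hpt hc R hRmem k (hw k)).trans ?_
  apply ENNReal.ofReal_le_ofReal
  have := lux_nonneg q (fun x => ‖R (x + (k : ℝ))‖)
  gcongr
  exact hC k

lemma conv_tendsto (p q : ℝ → ℝ≥0∞) (hp : Measurable p)
    (hp1 : ∀ᵐ x ∂(volume.restrict (Icc (0:ℝ) 1)), 1 ≤ p x)
    (hpt : ∀ᵐ x ∂(volume.restrict (Icc (0:ℝ) 1)), p x ≠ ∞)
    (hc : ∀ᵐ x ∂(volume.restrict (Icc (0:ℝ) 1)), 1 / p x + 1 / q x = 1)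
    (R : ℝ → X →L[ℂ] Y)
    (hRc : ∀ v : X, ContinuousOn (fun t => R t v) (Set.Ioi 0))
    (hRmem : ∀ k : ℕ, MemLpVar q (fun x => ‖R (x + (k : ℝ))‖))
    (hRsum : Summable (fun k : ℕ => luxNorm q (fun x => ‖R (x + (k : ℝ))‖)))
    {u : ℕ → ℝ → X} {v : ℝ → X}
    (hu : ∀ n, ∀ τ : ℝ, MemLpVar p (fun x => u n (τ + x)))
    (hv : ∀ τ : ℝ, MemLpVar p (fun x => v (τ + x))) {C D : ℝ}
    (hC : ∀ n, ∀ τ : ℝ, luxNorm p (fun x => u n (τ + x)) ≤ C)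
    (hD : ∀ τ : ℝ, luxNorm p (fun x => v (τ + x)) ≤ D)
    (hlim : ∀ τ : ℝ, Tendsto (fun n => luxNorm p (fun x => u n (τ + x) - v (τ + x))) atTop (𝓝 0)) :
    Tendsto (fun n => ∫ r in Ioi (0:ℝ), R r (u n r)) atTop (𝓝 (∫ r in Ioi (0:ℝ), R r (v r))) := by
  have iu := fun n => conv_integrable p q hp hp1 hpt hc R hRc hRmem hRsum (hu n) (hC n)
  have iv := conv_integrable p q hp hp1 hpt hc R hRc hRmem hRsum hv hD
  set A : ℕ → ℝ := fun k => luxNorm q (fun x => ‖R (x + (k : ℝ))‖) with hA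
  have hA0 : ∀ k, 0 ≤ A k := fun k => lux_nonneg q _
  rw [tendsto_iff_edist_tendsto_0]
  let d : ℕ → ℕ → ℝ≥0∞ := fun n k => ∫⁻ x in Icc (0:ℝ) 1, ‖R (k + x) (u n (k + x) - v (k + x))‖ₑ
  have hle : ∀ n, edist (∫ r in Ioi (0:ℝ), R r (u n r)) (∫ r in Ioi (0:ℝ), R r (v r)) ≤
      ∑' k, d n k := by
    intro n
    rw [edist_eq_enorm_sub, ← integral_sub (iu n) iv]
    refine (enorm_integral_le_lintegral_enorm _).trans ?_
    refine (lint_Ioi_le _).trans (le_of_eq (tsum_congr fun k => ?_))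
    simp only [d, map_sub]
  refine tendsto_of_tendsto_of_tendsto_of_le_of_le tendsto_const_nhds ?_ (fun n => zero_le) hle
  have hdt : ∀ k, Tendsto (fun n => d n k) atTop (𝓝 0) := by
    intro k
    have h1 : Tendsto (fun n => ENNReal.ofReal (2 * A k *
        luxNorm p (fun x => u n (k + x) - v (k + x)))) atTop (𝓝 0) := by
      have := ENNReal.tendsto_ofReal ((hlim k).const_mul (2 * A k))
      simpa using this
    refine tendsto_of_tendsto_of_tendsto_of_le_of_le tendsto_const_nhds h1 (fun n => zero_le) ?_
    intro n
    exact conv_bound p q hp hp1 hpt hc R hRmem (w := fun r => u n r - v r) k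
      (MemLpVar_sub p hp (hu n k) (hv k))
  have hdb : ∀ n k, d n k ≤ ENNReal.ofReal (2 * A k * C) + ENNReal.ofReal (2 * A k * D) := by
    intro n k
    have hm : AEStronglyMeasurable (fun x => R (k + x) (v (k + x)))
        (volume.restrict (Icc (0:ℝ) 1)) := by
      have h1 : AEStronglyMeasurable (fun r => R r (v r)) (volume.restrict (Icc (k:ℝ) (k + 1))) := by
        rw [← Measure.restrict_congr_set Ioc_ae_eq_Icc]
        refine iv.1.mono_measure (Measure.restrict_mono (fun r hr => ?_) le_rfl)
        exact lt_of_le_of_lt (Nat.cast_nonneg k) hr.1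
      exact ((mp_shift (k:ℝ)).aestronglyMeasurable_comp_iff (measurableEmbedding_addLeft _)).2 h1
    calc d n k ≤ ∫⁻ x in Icc (0:ℝ) 1, (‖R (k + x) (u n (k + x))‖ₑ + ‖R (k + x) (v (k + x))‖ₑ) := by
          apply lintegral_mono
          intro x
          simp only [map_sub]
          exact enorm_sub_le
      _ = _ := lintegral_add_right' _ hm.enorm
      _ ≤ _ := by
          have := hA0 k
          refine add_le_add ((conv_bound p q hp hp1 hpt hc R hRmem k (hu n k)).trans ?_)
            ((conv_bound p q hp hp1 hpt hc R hRmem k (hv k)).trans ?_)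
          · apply ENNReal.ofReal_le_ofReal
            exact mul_le_mul_of_nonneg_left (hC n k) (by positivity)
          · apply ENNReal.ofReal_le_ofReal
            exact mul_le_mul_of_nonneg_left (hD k) (by positivity)
  have := tendsto_lintegral_of_dominated_convergence (μ := Measure.count) (F := d) (f := fun _ => 0)
    (fun k => ENNReal.ofReal (2 * A k * C) + ENNReal.ofReal (2 * A k * D))
    (fun n => measurable_of_countable _) (fun n => Eventually.of_forall (hdb n)) ?_
    (Eventually.of_forall hdt)
  · simpa [lintegral_count] using this
  · rw [lintegral_count, ENNReal.tsum_add]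
    exact ENNReal.add_ne_top.2 ⟨((hRsum.mul_left 2).mul_right C).tsum_ofReal_ne_top,
      ((hRsum.mul_left 2).mul_right D).tsum_ofReal_ne_top⟩

end conv

lemma L1_bound {E : Type*} [NormedAddCommGroup E] (p q : ℝ → ℝ≥0∞) (hp : Measurable p)
    (hp1 : ∀ᵐ x ∂(volume.restrict (Icc (0:ℝ) 1)), 1 ≤ p x)
    (hpt : ∀ᵐ x ∂(volume.restrict (Icc (0:ℝ) 1)), p x ≠ ∞)
    (hc : ∀ᵐ x ∂(volume.restrict (Icc (0:ℝ) 1)), 1 / p x + 1 / q x = 1)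
    {w : ℝ → E} (hw : MemLpVar p w) :
    ∫⁻ x in Icc (0:ℝ) 1, ‖w x‖ₑ ≤
      ENNReal.ofReal (2 * luxNorm q (fun _ : ℝ => (1:ℝ)) * luxNorm p w) := by
  have h1 : MemLpVar q (fun _ : ℝ => (1:ℝ)) := by
    refine ⟨aestronglyMeasurable_const, 1, one_pos, ?_⟩
    unfold rhoVar
    refine lt_of_le_of_lt (lintegral_mono (g := fun _ => 1) fun x => ?_) (by simp)
    unfold phiVar
    split_ifs <;> simp_all
  refine le_trans (lintegral_mono fun x => ?_) (holder_var p q hp hp1 hpt hc h1 hw)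
  simp

lemma ae_eq_of_shift {E : Type*} [NormedAddCommGroup E] [NormedSpace ℝ E] [CompleteSpace E]
    {f h : ℝ → E} (hf : LocallyIntegrable f volume) (hh : LocallyIntegrable h volume)
    {c : ℕ → ℝ} (hc : Tendsto c atTop (𝓝 0))
    (hl : ∀ τ : ℝ, Tendsto (fun n => ∫⁻ x in Icc (0:ℝ) 1, ‖f (c n + τ + x) - h (τ + x)‖ₑ)
      atTop (𝓝 0)) : f =ᵐ[volume] h := by
  have fi : ∀ a b, IntervalIntegrable f volume a b := fun a b => 
    (hf.integrableOn_isCompact isCompact_uIcc).intervalIntegrable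
  have hi : ∀ a b, IntervalIntegrable h volume a b := fun a b => 
    (hh.integrableOn_isCompact isCompact_uIcc).intervalIntegrable
  have key : ∀ a b : ℝ, a ≤ b → b ≤ a + 1 → ∫ r in a..b, f r = ∫ r in a..b, h r := by
    intro a b hab hb
    have hF : Continuous (fun y => ∫ r in (0:ℝ)..y, f r) :=
      intervalIntegral.continuous_primitive fi 0
    have t1 : Tendsto (fun n => ∫ r in a..b, f (c n + r)) atTop (𝓝 (∫ r in a..b, f r)) := by
      have e : ∀ s, ∫ r in a..b, f (s + r) =
          (∫ r in (0:ℝ)..(s + b), f r) - ∫ r in (0:ℝ)..(s + a), f r := by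
        intro s
        rw [intervalIntegral.integral_comp_add_left (fun r => f r) s,
          intervalIntegral.integral_interval_sub_left (fi _ _) (fi _ _)]
      have hcont : Continuous (fun s => ∫ r in a..b, f (s + r)) := by
        simp_rw [e]
        exact (hF.comp (by fun_prop)).sub (hF.comp (by fun_prop))
      have := (hcont.tendsto 0).comp hc
      simpa [Function.comp_def] using this
    have t2 : Tendsto (fun n => ∫ r in a..b, f (c n + r)) atTop (𝓝 (∫ r in a..b, h r)) := by
      rw [tendsto_iff_edist_tendsto_0]
      refine tendsto_of_tendsto_of_tendsto_of_le_of_le tendsto_const_nhds (hl a)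
        (fun n => zero_le) (fun n => ?_)
      have fic : IntervalIntegrable (fun r => f (c n + r)) volume a b := by
        have := (fi (c n + a) (c n + b)).comp_add_left (c n)
        simpa using this
      rw [edist_eq_enorm_sub, ← intervalIntegral.integral_sub fic (hi _ _),
        intervalIntegral.integral_of_le hab]
      refine (enorm_integral_le_lintegral_enorm _).trans ?_
      refine (lintegral_mono_set (t := Icc a (a + 1)) ?_).trans ?_
      · exact fun r hr => ⟨hr.1.le, hr.2.trans hb⟩
      · rw [lint_shift]
        simp only [add_assoc, le_refl]
    exact tendsto_nhds_unique t1 t2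
  filter_upwards [_root_.LocallyIntegrable.ae_hasDerivAt_integral hf,
    _root_.LocallyIntegrable.ae_hasDerivAt_integral hh] with x h1 h2
  refine (h1 (x - 1 / 2)).unique ((h2 (x - 1 / 2)).congr_of_eventuallyEq ?_)
  filter_upwards [Ioo_mem_nhds (show x - 1 / 2 < x by linarith) (show x < x + 1 / 2 by linarith)]
    with y hy
  exact key _ _ hy.1.le (by linarith [hy.2])

lemma locInt {E : Type*} [NormedAddCommGroup E] (p q : ℝ → ℝ≥0∞) (hp : Measurable p)
    (hp1 : ∀ᵐ x ∂(volume.restrict (Icc (0:ℝ) 1)), 1 ≤ p x)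
    (hpt : ∀ᵐ x ∂(volume.restrict (Icc (0:ℝ) 1)), p x ≠ ∞)
    (hc : ∀ᵐ x ∂(volume.restrict (Icc (0:ℝ) 1)), 1 / p x + 1 / q x = 1)
    {w : ℝ → E} (hw : ∀ τ : ℝ, MemLpVar p (fun x => w (τ + x))) :
    LocallyIntegrable w volume := by
  intro x
  refine ⟨Icc (x - 1 / 2) (x - 1 / 2 + 1), Icc_mem_nhds (by linarith) (by linarith), ?_⟩
  refine ⟨(glob_aesm fun τ => (hw τ).1).restrict, ?_⟩
  unfold HasFiniteIntegral
  rw [lint_shift]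
  exact lt_of_le_of_lt (L1_bound p q hp hp1 hpt hc (hw _)) ENNReal.ofReal_lt_top

lemma flip_integral {E : Type*} [NormedAddCommGroup E] [NormedSpace ℝ E] (t : ℝ) (F : ℝ → E) :
    ∫ s in Iic t, F (t - s) = ∫ r in Ioi (0:ℝ), F r := by
  have h := (Measure.measurePreserving_sub_left (volume : Measure ℝ) t).setIntegral_preimage_emb
    (MeasurableEquiv.subLeft t).measurableEmbedding F (Ici 0)
  rw [← integral_Ici_eq_integral_Ioi, ← h]
  congr 2
  ext s; simp

lemma flip_integrable {E : Type*} [NormedAddCommGroup E] (t : ℝ) (F : ℝ → E)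
    (hF : IntegrableOn F (Ioi 0)) : IntegrableOn (fun s => F (t - s)) (Iic t) := by
  have h := ((Measure.measurePreserving_sub_left (volume : Measure ℝ) t).integrableOn_comp_preimage
    (MeasurableEquiv.subLeft t).measurableEmbedding (f := F) (s := Ici 0)).2
      ((integrableOn_Ici_iff_integrableOn_Ioi (by simp)).2 hF)
  have hs : (fun s => t - s) ⁻¹' Ici 0 = Iic t := by
    ext s; simp
  rw [hs] at h
  exact h

/-- if p ∈ D₊([0,1]), 1/p + 1/q = 1 a.e., the operator family (R(t))_{t>0} is
strongly continuous with M := Σ_k ‖‖R(·+k)‖‖_{L^{q(x)}[0,1]} < ∞, and ǧ is Stepanov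
p(x)-almost automorphic, then G(t) = ∫_{-∞}^t R(t-s)g(s)ds converges absolutely and is
almost automorphic. -/
theorem convolution_product_almost_automorphic
    {X Y : Type*} [NormedAddCommGroup X] [NormedSpace ℂ X] [CompleteSpace X]
    [NormedAddCommGroup Y] [NormedSpace ℂ Y] [CompleteSpace Y]
    (p qe : ℝ → ℝ≥0∞) (hpmeas : Measurable p) (hqemeas : Measurable qe)
    (hp1 : ∀ x ∈ Set.Icc (0:ℝ) 1, 1 ≤ p x)
    (pp : ℝ)
    (hpp : ∀ᵐ x ∂(MeasureTheory.volume.restrict (Set.Icc (0:ℝ) 1)),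
      p x ≤ ENNReal.ofReal pp)
    (hconj : ∀ᵐ x ∂(MeasureTheory.volume.restrict (Set.Icc (0:ℝ) 1)),
      1 / p x + 1 / qe x = 1)
    (R : ℝ → X →L[ℂ] Y)
    (hRc : ∀ v : X, ContinuousOn (fun t => R t v) (Set.Ioi 0))
    (hRmem : ∀ k : ℕ, MemLpVar qe (fun x => ‖R (x + (k : ℝ))‖))
    (hRsum : Summable (fun k : ℕ => luxNorm qe (fun x => ‖R (x + (k : ℝ))‖)))
    (g : ℝ → X) (hg : AASVar p (fun t => g (-t))) :
    (∀ t : ℝ, MeasureTheory.IntegrableOn (fun s => R (t - s) (g s)) (Set.Iic t)) ∧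
    AlmostAutomorphic (fun t => ∫ s in Set.Iic t, R (t - s) (g s)) := by
  have hp1' : ∀ᵐ x ∂(volume.restrict (Icc (0:ℝ) 1)), 1 ≤ p x :=
    (ae_restrict_iff' measurableSet_Icc).2 (Eventually.of_forall hp1)
  have hpt : ∀ᵐ x ∂(volume.restrict (Icc (0:ℝ) 1)), p x ≠ ∞ := by
    filter_upwards [hpp] with x hx using ne_top_of_le_ne_top ENNReal.ofReal_ne_top hx
  set f : ℝ → X := fun t => g (-t) with hfdef
  obtain ⟨⟨hfm, C, hfC⟩, haas⟩ := hg
  replace hfC : ∀ τ : ℝ, luxNorm p (fun x => f (τ + x)) ≤ C :=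
    fun τ => hfC (mem_image_of_mem _ (mem_univ τ))
  replace hfm : ∀ τ : ℝ, MemLpVar p (fun x => f (τ + x)) := fun τ => hfm τ (mem_univ τ)
  have hG : (fun t => ∫ s in Set.Iic t, R (t - s) (g s)) =
      fun t => ∫ r in Ioi (0:ℝ), R r (f (-t + r)) := by
    funext t
    rw [← flip_integral t (fun r => R r (f (-t + r)))]
    simp [hfdef]
  have sh : ∀ (w : ℝ → X) (a τ : ℝ), (fun x => w (a + (τ + x))) = fun x => w (a + τ + x) := by
    intro w a τ; funext x; rw [add_assoc]
  refine ⟨fun t => ?_, ?_⟩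
  · have h1 : IntegrableOn (fun r => R r (f (-t + r))) (Ioi 0) :=
      conv_integrable p qe hpmeas hp1' hpt hconj R hRc hRmem hRsum
        (w := fun r => f (-t + r)) (C := C)
        (fun τ => by rw [sh]; exact hfm _) (fun τ => by rw [sh]; exact hfC _)
    have h2 := flip_integrable t _ h1
    simpa [hfdef] using h2
  rw [hG]
  have core : ∀ b : ℕ → ℝ, ∃ n : ℕ → ℕ, StrictMono n ∧ ∃ h : ℝ → X,
      (∀ τ : ℝ, MemLpVar p (fun x => h (τ + x))) ∧
      (∀ τ : ℝ, Tendsto (fun k => luxNorm p (fun x => f (-b (n k) + τ + x) - h (τ + x)))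
        atTop (𝓝 0)) ∧
      (∀ t : ℝ, Tendsto (fun k => ∫ r in Ioi (0:ℝ), R r (f (-(t + b (n k)) + r))) atTop
        (𝓝 (∫ r in Ioi (0:ℝ), R r (h (-t + r))))) ∧
      (∀ t : ℝ, Tendsto (fun k => ∫ r in Ioi (0:ℝ), R r (h (-(t - b (n k)) + r))) atTop
        (𝓝 (∫ r in Ioi (0:ℝ), R r (f (-t + r))))) := by
    intro b
    obtain ⟨n, hn, h, ⟨hhm, D, hhD⟩, hlim⟩ := haas (fun k => -b k)
    replace hhD : ∀ τ : ℝ, luxNorm p (fun x => h (τ + x)) ≤ D :=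
      fun τ => hhD (mem_image_of_mem _ (mem_univ τ))
    replace hhm : ∀ τ : ℝ, MemLpVar p (fun x => h (τ + x)) := fun τ => hhm τ (mem_univ τ)
    refine ⟨n, hn, h, hhm, fun τ => (hlim τ).1, fun t => ?_, fun t => ?_⟩
    · refine conv_tendsto p qe hpmeas hp1' hpt hconj R hRc hRmem hRsum
        (u := fun k r => f (-(t + b (n k)) + r)) (v := fun r => h (-t + r)) (C := C) (D := D)
        (fun k τ => by rw [sh]; exact hfm _) (fun τ => by rw [sh]; exact hhm _)
        (fun k τ => by rw [sh]; exact hfC _) (fun τ => by rw [sh]; exact hhD _) (fun τ => ?_)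
      refine (hlim (-t + τ)).1.congr fun k => ?_
      congr 1
      funext x
      congr 2 <;> ring
    · refine conv_tendsto p qe hpmeas hp1' hpt hconj R hRc hRmem hRsum
        (u := fun k r => h (-(t - b (n k)) + r)) (v := fun r => f (-t + r)) (C := D) (D := C)
        (fun k τ => by rw [sh]; exact hhm _) (fun τ => by rw [sh]; exact hfm _)
        (fun k τ => by rw [sh]; exact hhD _) (fun τ => by rw [sh]; exact hfC _) (fun τ => ?_)
      refine (hlim (-t + τ)).2.congr fun k => ?_
      congr 1
      funext x
      congr 2 <;> ring
  refine ⟨?_, fun b => ?_⟩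
  · rw [continuous_iff_continuousAt]
    intro t
    refine tendsto_of_subseq_tendsto fun ts hts => ?_
    obtain ⟨n, hn, h, hhm, hlux, hconv, -⟩ := core (fun k => ts k - t)
    refine ⟨n, ?_⟩
    letI : NormedSpace ℝ X := NormedSpace.restrictScalars ℝ ℂ X
    have hc0 : Tendsto (fun k => -(ts (n k) - t)) atTop (𝓝 0) := by
      have := ((hts.comp hn.tendsto_atTop).sub_const t).neg
      simpa using this
    have hae : f =ᵐ[volume] h := by
      refine ae_eq_of_shift (locInt p qe hpmeas hp1' hpt hconj hfm)
        (locInt p qe hpmeas hp1' hpt hconj hhm) hc0 fun τ => ?_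
      have h1 := ENNReal.tendsto_ofReal
        ((hlux τ).const_mul (2 * luxNorm qe (fun _ : ℝ => (1:ℝ))))
      rw [mul_zero, ENNReal.ofReal_zero] at h1
      refine tendsto_of_tendsto_of_tendsto_of_le_of_le tendsto_const_nhds h1 (fun n => zero_le)
        fun k => ?_
      exact L1_bound p qe hpmeas hp1' hpt hconj (MemLpVar_sub p hpmeas (hfm _) (hhm _))
    have he : ∫ r in Ioi (0:ℝ), R r (f (-t + r)) = ∫ r in Ioi (0:ℝ), R r (h (-t + r)) := by
      apply integral_congr_ae
      apply ae_restrict_of_ae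
      have := (measurePreserving_add_left (volume : Measure ℝ) (-t)).quasiMeasurePreserving.ae_eq_comp hae
      filter_upwards [this] with r hr
      simp only [Function.comp_apply] at hr
      rw [hr]
    have h2 := hconv t
    simp only [add_sub_cancel] at h2
    rw [← he] at h2
    exact h2
  · obtain ⟨n, hn, h, -, -, h1, h2⟩ := core b
    exact ⟨n, hn, fun t => ∫ r in Ioi (0:ℝ), R r (h (-t + r)), h1, h2⟩

end
end

section
/- Let p : [0,1] → [1,∞] be Lebesgue measurable, let q : [0,1] → [1,∞] satisfy 1/p(x) + 1/q(x) = 1 for a.e. x ∈ [0,1], and let (R(t))_{t>0} be a family of bounded linear operators X → Y between complex Banach spaces that is strongly continuous on (0,∞) and satisfies M := Σ_{k=0}^{∞} ‖ ‖R(·+k)‖_{L(X,Y)} ‖_{L^{q(x)}[0,1]} < ∞. Let g : ℝ → X be such that ǧ(t) := g(−t) is Stepanov p(x)-almost automorphic, and assume additionally that the map t ↦ ǧ(· − t)|_{[0,1]} from ℝ into L^{p(x)}([0,1]:X) is continuous. Then for every t ∈ ℝ the integral G(t) := ∫_{−∞}^{t} R(t−s) g(s) ds converges absolutely, and G : ℝ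 → Y is almost automorphic. -/
open MeasureTheory Filter Topology Set
open scoped ENNReal

noncomputable section

lemma phiVar_mono (p : ℝ → ℝ≥0∞) (x : ℝ) {a b : ℝ} (ha : 0 ≤ a) (hab : a ≤ b) :
    phiVar p x a ≤ phiVar p x b := by
  unfold phiVar
  split_ifs with h1 h2 h3 h4
  · exact ENNReal.ofReal_le_ofReal (Real.rpow_le_rpow ha hab ENNReal.toReal_nonneg)
  · exact le_rfl
  · exact zero_le
  · linarith
  · exact le_rfl

lemma phiVar_scale (p : ℝ → ℝ≥0∞) (x : ℝ) (hp : 1 ≤ p x) {a ε : ℝ} (ha : 0 ≤ a)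
    (hε : 0 < ε) (hε1 : ε ≤ 1) :
    phiVar p x (ε * a) ≤ ENNReal.ofReal ε * phiVar p x a := by
  unfold phiVar
  by_cases h1 : p x ≠ ∞
  · rw [if_pos h1, if_pos h1, ← ENNReal.ofReal_mul hε.le]
    apply ENNReal.ofReal_le_ofReal
    rw [Real.mul_rpow hε.le ha]
    have h2 : 1 ≤ (p x).toReal := by
      rw [← ENNReal.toReal_one]; exact ENNReal.toReal_mono h1 hp
    have h3 : ε ^ (p x).toReal ≤ ε ^ (1:ℝ) :=
      Real.rpow_le_rpow_of_exponent_ge hε hε1 h2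
    rw [Real.rpow_one] at h3
    exact mul_le_mul_of_nonneg_right h3 (Real.rpow_nonneg ha _)
  · rw [if_neg h1, if_neg h1]
    by_cases h2 : a ≤ 1
    · have : ε * a ≤ 1 := by nlinarith
      simp [h2, this]
    · rw [if_neg h2, ENNReal.mul_top (by simpa using hε)]
      exact le_top

lemma phiVar_max (p : ℝ → ℝ≥0∞) (x : ℝ) {a b c : ℝ} (hc : 0 ≤ c) (h : c ≤ max a b) :
    phiVar p x c ≤ phiVar p x a + phiVar p x b := by
  rcases le_max_iff.1 h with h | h
  · exact (phiVar_mono p x hc h).trans le_self_add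
  · exact (phiVar_mono p x hc h).trans le_add_self

lemma phiVar_aemeas {p : ℝ → ℝ≥0∞} (hp : Measurable p) {μ : Measure ℝ} {u : ℝ → ℝ}
    (hu : AEMeasurable u μ) : AEMeasurable (fun x => phiVar p x (u x)) μ := by
  have hm : Measurable (fun z : ℝ≥0∞ × ℝ =>
      if z.1 ≠ ∞ then ENNReal.ofReal (z.2 ^ z.1.toReal) else if z.2 ≤ 1 then 0 else (∞ : ℝ≥0∞)) := by
    refine Measurable.ite ?_ ?_ (Measurable.ite ?_ measurable_const measurable_const)
    · exact (measurableSet_singleton (∞ : ℝ≥0∞)).compl.preimage measurable_fst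
    · exact (measurable_snd.pow measurable_fst.ennreal_toReal).ennreal_ofReal
    · exact measurableSet_Iic.preimage measurable_snd
  exact hm.comp_aemeasurable (hp.aemeasurable.prodMk hu)

lemma phiVar_young (p q : ℝ → ℝ≥0∞) (x : ℝ) (h : 1 / p x + 1 / q x = 1) {a b : ℝ}
    (ha : 0 ≤ a) (hb : 0 ≤ b) :
    ENNReal.ofReal (a * b) ≤ phiVar p x a + phiVar q x b := by
  have key : ∀ (p q : ℝ → ℝ≥0∞) (a b : ℝ), 0 ≤ a → 0 ≤ b → 1 / p x + 1 / q x = 1 → p x = ∞ →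
      ENNReal.ofReal (a * b) ≤ phiVar p x a + phiVar q x b := by
    intro p q a b ha hb h hpi
    have hq : q x = 1 := by simpa [hpi] using h
    unfold phiVar
    by_cases h2 : a ≤ 1
    · simp only [hpi, hq, h2]
      simp
      exact ENNReal.ofReal_le_ofReal (by nlinarith)
    · simp [hpi, h2]
  by_cases hpi : p x = ∞
  · exact key p q a b ha hb h hpi
  by_cases hqi : q x = ∞
  · rw [mul_comm, add_comm]
    exact key q p b a hb ha (by rw [add_comm]; exact h) hqi
  have hp0 : p x ≠ 0 := by
    intro h0; simp [h0] at h
  have hq0 : q x ≠ 0 := by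
    intro h0; simp [h0] at h
  have hpp : 0 < (p x).toReal := ENNReal.toReal_pos hp0 hpi
  have hqp : 0 < (q x).toReal := ENNReal.toReal_pos hq0 hqi
  have hr : (p x).toReal⁻¹ + (q x).toReal⁻¹ = 1 := by
    rw [← ENNReal.toReal_inv, ← ENNReal.toReal_inv, ← ENNReal.toReal_add (by simpa using hp0) (by simpa using hq0)]
    simp only [one_div] at h
    rw [h]; simp
  have hc : (p x).toReal.HolderConjugate (q x).toReal :=
    Real.holderConjugate_iff.2 ⟨by
      by_contra hh
      have : 1 ≤ (p x).toReal⁻¹ := (one_le_inv₀ hpp).2 (not_lt.1 hh)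
      have := inv_pos.2 hqp
      linarith, hr⟩
  have hy := Real.young_inequality_of_nonneg ha hb hc
  have h1 : 1 ≤ (p x).toReal := hc.lt.le
  have h2 : 1 ≤ (q x).toReal := hc.symm.lt.le
  unfold phiVar
  rw [if_pos hpi, if_pos hqi, ← ENNReal.ofReal_add (Real.rpow_nonneg ha _) (Real.rpow_nonneg hb _)]
  apply ENNReal.ofReal_le_ofReal
  have h3 := div_le_self (Real.rpow_nonneg ha (p x).toReal) h1
  have h4 := div_le_self (Real.rpow_nonneg hb (q x).toReal) h2
  linarith

section lux
variable {E : Type*} [NormedAddCommGroup E]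

lemma rhoVar_scale {p : ℝ → ℝ≥0∞}
    (hp1 : ∀ᵐ x ∂(volume.restrict (Set.Icc (0:ℝ) 1)), 1 ≤ p x) {u : ℝ → ℝ} (hu : ∀ x, 0 ≤ u x)
    {ε : ℝ} (hε : 0 < ε) (hε1 : ε ≤ 1) :
    rhoVar p (fun x => ε * u x) ≤ ENNReal.ofReal ε * rhoVar p u := by
  unfold rhoVar
  rw [← lintegral_const_mul' _ _ ENNReal.ofReal_ne_top]
  apply lintegral_mono_ae
  filter_upwards [hp1] with x hx
  exact phiVar_scale p x hx (hu x) hε hε1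

lemma luxNorm_nonneg (p : ℝ → ℝ≥0∞) (f : ℝ → E) : 0 ≤ luxNorm p f :=
  Real.sInf_nonneg fun _ h => h.1.le

lemma luxNorm_le {p : ℝ → ℝ≥0∞} {f : ℝ → E} {c : ℝ} (hc : 0 < c)
    (h : rhoVar p (fun x => ‖f x‖ / c) ≤ 1) : luxNorm p f ≤ c :=
  csInf_le ⟨0, fun _ h => h.1.le⟩ ⟨hc, h⟩

lemma luxNorm_mem {p : ℝ → ℝ≥0∞}
    (hp1 : ∀ᵐ x ∂(volume.restrict (Set.Icc (0:ℝ) 1)), 1 ≤ p x) {f : ℝ → E}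
    (hf : MemLpVar p f) {δ : ℝ} (hδ : 0 < δ) :
    rhoVar p (fun x => ‖f x‖ / (luxNorm p f + δ)) ≤ 1 := by
  have hne : {lam : ℝ | 0 < lam ∧ rhoVar p (fun x => ‖f x‖ / lam) ≤ 1}.Nonempty := by
    obtain ⟨-, c, hc, hfin⟩ := hf
    set A := rhoVar p (fun x => c * ‖f x‖) with hA
    have hA0 : 0 ≤ A.toReal := ENNReal.toReal_nonneg
    set ε : ℝ := (A.toReal + 1)⁻¹ with hε
    have hε0 : 0 < ε := by positivity
    have hε1 : ε ≤ 1 := inv_le_one_of_one_le₀ (by linarith)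
    refine ⟨(ε * c)⁻¹, by positivity, ?_⟩
    have := rhoVar_scale hp1 (u := fun x => c * ‖f x‖) (fun x => by positivity) hε0 hε1
    have e : (fun x => ‖f x‖ / (ε * c)⁻¹) = fun x => ε * (c * ‖f x‖) := by
      funext x; rw [div_inv_eq_mul]; ring
    rw [e]
    refine this.trans ?_
    rw [← hA, ← ENNReal.ofReal_toReal hfin.ne, ← ENNReal.ofReal_mul hε0.le]
    rw [← ENNReal.ofReal_one]
    apply ENNReal.ofReal_le_ofReal
    rw [hε, inv_mul_le_iff₀ (by positivity)]; linarith
  obtain ⟨l, ⟨hl0, hl⟩, hlt⟩ := exists_lt_of_csInf_lt hne (lt_add_of_pos_right _ hδ)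
  refine le_trans ?_ hl
  apply lintegral_mono
  intro x
  have : l ≤ luxNorm p f + δ := hlt.le
  exact phiVar_mono p x (by have := luxNorm_nonneg p f; positivity)
    (div_le_div_of_nonneg_left (norm_nonneg _) hl0 this)

lemma MemLpVar.sub {p : ℝ → ℝ≥0∞} (hpm : Measurable p) {f g : ℝ → E}
    (hf : MemLpVar p f) (hg : MemLpVar p g) : MemLpVar p (fun x => f x - g x) := by
  obtain ⟨hfm, c, hc, hfc⟩ := hf
  obtain ⟨hgm, d, hd, hgd⟩ := hg
  refine ⟨hfm.sub hgm, min c d / 2, by positivity, ?_⟩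
  refine lt_of_le_of_lt ?_ (ENNReal.add_lt_top.2 ⟨hfc, hgd⟩)
  unfold rhoVar
  rw [← lintegral_add_left' (phiVar_aemeas hpm (hfm.norm.aemeasurable.const_mul c))]
  apply lintegral_mono
  intro x
  have hm : 0 < min c d := by positivity
  apply phiVar_max p x (by positivity)
  have h1 : min c d / 2 * ‖f x - g x‖ ≤ (min c d * ‖f x‖ + min c d * ‖g x‖) / 2 := by
    nlinarith [norm_sub_le (f x) (g x)]
  have h2 : min c d * ‖f x‖ ≤ c * ‖f x‖ := by gcongr; exact min_le_left _ _
  have h3 : min c d * ‖g x‖ ≤ d * ‖g x‖ := by gcongr; exact min_le_right _ _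
  have h4 := le_max_left (c * ‖f x‖) (d * ‖g x‖)
  have h5 := le_max_right (c * ‖f x‖) (d * ‖g x‖)
  linarith

lemma luxNorm_sub_le {p : ℝ → ℝ≥0∞} (hpm : Measurable p)
    (hp1 : ∀ᵐ x ∂(volume.restrict (Set.Icc (0:ℝ) 1)), 1 ≤ p x) {f g : ℝ → E}
    (hf : MemLpVar p f) (hg : MemLpVar p g) :
    luxNorm p (fun x => f x - g x) ≤ 2 * (luxNorm p f + luxNorm p g + 2) := by
  have hF := luxNorm_mem hp1 hf one_pos
  have hG := luxNorm_mem hp1 hg one_pos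
  have hf0 := luxNorm_nonneg p f
  have hg0 := luxNorm_nonneg p g
  set a := luxNorm p f + 1 with ha
  set b := luxNorm p g + 1 with hb
  have ha0 : 0 < a := by positivity
  have hb0 : 0 < b := by positivity
  have e : 2 * (luxNorm p f + luxNorm p g + 2) = 2 * (a + b) := by rw [ha, hb]; ring
  rw [e]
  apply luxNorm_le (by positivity)
  have e2 : (fun x => ‖f x - g x‖ / (2 * (a + b))) = fun x => (1/2) * (‖f x - g x‖ / (a + b)) := by
    funext x; field_simp
  rw [e2]
  refine (rhoVar_scale hp1 (u := fun x => ‖f x - g x‖ / (a + b)) (fun x => by positivity)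
    (by norm_num) (by norm_num)).trans ?_
  have h2 : rhoVar p (fun x => ‖f x - g x‖ / (a + b)) ≤ 1 + 1 := by
    refine le_trans ?_ (add_le_add hF hG)
    unfold rhoVar
    rw [← lintegral_add_left' (phiVar_aemeas hpm (hf.1.norm.aemeasurable.div_const a))]
    apply lintegral_mono
    intro x
    apply phiVar_max p x (by positivity)
    rw [div_le_iff₀ (by positivity)]
    have h4 := le_max_left (‖f x‖ / a) (‖g x‖ / b)
    have h5 := le_max_right (‖f x‖ / a) (‖g x‖ / b)
    rw [div_le_iff₀ (by positivity)] at h4 h5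
    linarith [norm_sub_le (f x) (g x)]
  calc _ ≤ ENNReal.ofReal (1/2) * (1 + 1) := by gcongr
    _ = 1 := by
      rw [one_add_one_eq_two, show (2:ℝ≥0∞) = ENNReal.ofReal 2 by simp,
        ← ENNReal.ofReal_mul (by norm_num)]
      norm_num

lemma holder_lux {F : Type*} [NormedAddCommGroup F] {p q : ℝ → ℝ≥0∞} (hpm : Measurable p)
    (hp1 : ∀ᵐ x ∂(volume.restrict (Set.Icc (0:ℝ) 1)), 1 ≤ p x)
    (hq1 : ∀ᵐ x ∂(volume.restrict (Set.Icc (0:ℝ) 1)), 1 ≤ q x)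
    (hconj : ∀ᵐ x ∂(volume.restrict (Set.Icc (0:ℝ) 1)), 1 / p x + 1 / q x = 1)
    {f : ℝ → E} {r : ℝ → F} (hf : MemLpVar p f) (hr : MemLpVar q r) :
    ∫⁻ x in Set.Icc (0:ℝ) 1, ‖r x‖ₑ * ‖f x‖ₑ ≤
      ENNReal.ofReal (2 * (luxNorm q r * luxNorm p f)) := by
  have hf0 := luxNorm_nonneg p f
  have hr0 := luxNorm_nonneg q r
  have key : ∀ δ : ℝ, 0 < δ → ∫⁻ x in Set.Icc (0:ℝ) 1, ‖r x‖ₑ * ‖f x‖ₑ ≤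
      ENNReal.ofReal (2 * ((luxNorm q r + δ) * (luxNorm p f + δ))) := by
    intro δ hδ
    have hF := luxNorm_mem hp1 hf hδ
    have hR := luxNorm_mem hq1 hr hδ
    set a := luxNorm p f + δ with ha
    set b := luxNorm q r + δ with hb
    have ha0 : 0 < a := by positivity
    have hb0 : 0 < b := by positivity
    have h1 : ∫⁻ x in Set.Icc (0:ℝ) 1, ENNReal.ofReal ((‖f x‖ / a) * (‖r x‖ / b)) ≤ 1 + 1 := by
      refine le_trans ?_ (add_le_add hF hR)
      unfold rhoVar
      rw [← lintegral_add_left' (phiVar_aemeas hpm (hf.1.norm.aemeasurable.div_const a))]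
      apply lintegral_mono_ae
      filter_upwards [hconj] with x hx
      exact phiVar_young p q x hx (by positivity) (by positivity)
    calc _ = ∫⁻ x in Set.Icc (0:ℝ) 1,
          ENNReal.ofReal (b * a) * ENNReal.ofReal ((‖f x‖ / a) * (‖r x‖ / b)) := by
          congr 1; funext x
          rw [← ENNReal.ofReal_mul (by positivity), ← ofReal_norm, ← ofReal_norm,
            ← ENNReal.ofReal_mul (by positivity)]
          congr 1; field_simp
      _ = ENNReal.ofReal (b * a) * ∫⁻ x in Set.Icc (0:ℝ) 1,
          ENNReal.ofReal ((‖f x‖ / a) * (‖r x‖ / b)) :=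
          lintegral_const_mul' _ _ ENNReal.ofReal_ne_top
      _ ≤ ENNReal.ofReal (b * a) * 2 := by
          rw [one_add_one_eq_two] at h1; gcongr
      _ = _ := by
          rw [mul_comm, ENNReal.ofReal_mul (p := 2) (by norm_num)]; simp
  have ht : Tendsto (fun δ : ℝ => ENNReal.ofReal (2 * ((luxNorm q r + δ) * (luxNorm p f + δ))))
      (𝓝[>] 0) (𝓝 (ENNReal.ofReal (2 * (luxNorm q r * luxNorm p f)))) := by
    apply tendsto_nhdsWithin_of_tendsto_nhds
    have : Continuous (fun δ : ℝ =>
        ENNReal.ofReal (2 * ((luxNorm q r + δ) * (luxNorm p f + δ)))) :=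
      ENNReal.continuous_ofReal.comp (by fun_prop)
    simpa using this.tendsto 0
  exact ge_of_tendsto ht (by filter_upwards [self_mem_nhdsWithin] with δ hδ using key δ hδ)

end lux

lemma aesm_apply {X Y : Type*} [NormedAddCommGroup X] [NormedSpace ℂ X]
    [NormedAddCommGroup Y] [NormedSpace ℂ Y] (R : ℝ → X →L[ℂ] Y)
    (hRc : ∀ v : X, ContinuousOn (fun t => R t v) (Set.Ioi 0)) {w : ℝ → X}
    (hw : AEStronglyMeasurable w (volume.restrict (Ioi (0:ℝ)))) :
    AEStronglyMeasurable (fun s => R s (w s)) (volume.restrict (Ioi (0:ℝ))) := by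
  obtain ⟨w', hw', hae⟩ := hw
  have h1 : AEStronglyMeasurable (fun s => R s (w' s)) (volume.restrict (Ioi (0:ℝ))) := by
    have hs : ∀ n, AEStronglyMeasurable (fun s => R s (hw'.approx n s))
        (volume.restrict (Ioi (0:ℝ))) := by
      intro n
      classical
      have e : (fun s => R s (hw'.approx n s)) = fun s => ∑ y ∈ (hw'.approx n).range,
          (hw'.approx n ⁻¹' {y}).indicator (fun s => R s y) s := by
        funext s
        rw [Finset.sum_eq_single (hw'.approx n s)]
        · simp
        · intro y _ hy
          rw [indicator_of_notMem]
          simpa using fun h => hy h.symm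
        · intro h; exact absurd (SimpleFunc.mem_range_self _ _) h
      rw [e]
      refine Finset.aestronglyMeasurable_fun_sum _ (fun y _ => ?_)
      exact ((hRc y).aestronglyMeasurable measurableSet_Ioi).indicator
        (SimpleFunc.measurableSet_fiber _ _)
    refine aestronglyMeasurable_of_tendsto_ae atTop hs (Eventually.of_forall fun s => ?_)
    exact ((R s).continuous.tendsto _).comp (hw'.tendsto_approx s)
  refine h1.congr ?_
  filter_upwards [hae] with s hs
  rw [hs]

lemma Ioi_eq_iUnion : Ioi (0:ℝ) = ⋃ k : ℕ, Ioc (k:ℝ) (k + 1) := by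
  ext s
  simp only [mem_Ioi, mem_iUnion, mem_Ioc]
  constructor
  · intro hs
    have h0 : 0 < ⌈s⌉₊ := Nat.ceil_pos.2 hs
    obtain ⟨m, hm⟩ := Nat.exists_eq_succ_of_ne_zero h0.ne'
    refine ⟨m, ?_, ?_⟩
    · exact Nat.lt_ceil.1 (by omega)
    · have := Nat.le_ceil s
      rw [hm] at this
      push_cast at this
      linarith
  · rintro ⟨k, hk, -⟩
    exact lt_of_le_of_lt (Nat.cast_nonneg k) hk

lemma conv_bound_s17 {X Y : Type*} [NormedAddCommGroup X] [NormedSpace ℂ X]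
    [NormedAddCommGroup Y] [NormedSpace ℂ Y]
    {p qe : ℝ → ℝ≥0∞} (hpm : Measurable p)
    (hp1 : ∀ᵐ x ∂(volume.restrict (Set.Icc (0:ℝ) 1)), 1 ≤ p x)
    (hq1 : ∀ᵐ x ∂(volume.restrict (Set.Icc (0:ℝ) 1)), 1 ≤ qe x)
    (hconj : ∀ᵐ x ∂(volume.restrict (Set.Icc (0:ℝ) 1)), 1 / p x + 1 / qe x = 1)
    (R : ℝ → X →L[ℂ] Y)
    (hRc : ∀ v : X, ContinuousOn (fun t => R t v) (Set.Ioi 0))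
    (hRmem : ∀ k : ℕ, MemLpVar qe (fun x => ‖R (x + (k : ℝ))‖))
    (hRsum : Summable (fun k : ℕ => luxNorm qe (fun x => ‖R (x + (k : ℝ))‖)))
    {w : ℝ → X} (hw : ∀ k : ℕ, MemLpVar p (fun x => w (k + x))) {B : ℝ}
    (hB : ∀ k : ℕ, luxNorm p (fun x => w (k + x)) ≤ B) :
    IntegrableOn (fun s => R s (w s)) (Ioi 0) ∧
    ‖∫ s in Ioi 0, R s (w s)‖ ≤ ∑' k : ℕ, 2 * (luxNorm qe (fun x => ‖R (x + (k : ℝ))‖) *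
      luxNorm p (fun x => w (k + x))) := by
  have hsum : Summable (fun k : ℕ => 2 * (luxNorm qe (fun x => ‖R (x + (k : ℝ))‖) *
      luxNorm p (fun x => w (k + x)))) := by
    refine Summable.mul_left 2 (Summable.of_nonneg_of_le (fun k => ?_) (fun k => ?_)
      (hRsum.mul_right B))
    · exact mul_nonneg (luxNorm_nonneg _ _) (luxNorm_nonneg _ _)
    · exact mul_le_mul_of_nonneg_left (hB k) (luxNorm_nonneg _ _)
  have hnn : ∀ k : ℕ, 0 ≤ 2 * (luxNorm qe (fun x => ‖R (x + (k : ℝ))‖) *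
      luxNorm p (fun x => w (k + x))) := fun k =>
    mul_nonneg zero_le_two (mul_nonneg (luxNorm_nonneg _ _) (luxNorm_nonneg _ _))
  have hpre : ∀ k : ℕ, (fun x : ℝ => (k:ℝ) + x) ⁻¹' (Icc (k:ℝ) (k+1)) = Icc 0 1 := by
    intro k; ext x; simp
  have hemb : ∀ k : ℕ, MeasurableEmbedding (fun x : ℝ => (k:ℝ) + x) := fun k =>
    measurableEmbedding_addLeft _
  have hmp : ∀ k : ℕ, MeasurePreserving (fun x : ℝ => (k:ℝ) + x) volume volume := fun k =>
    measurePreserving_add_left volume _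
  have hwm : AEStronglyMeasurable w (volume.restrict (Ioi (0:ℝ))) := by
    rw [Ioi_eq_iUnion, aestronglyMeasurable_iUnion_iff]
    intro k
    have h1 : AEStronglyMeasurable w (volume.restrict (Icc (k:ℝ) (k+1))) := by
      have h2 := (hmp k).restrict_preimage_emb (hemb k) (Icc (k:ℝ) (k+1))
      rw [hpre] at h2
      exact (h2.aestronglyMeasurable_comp_iff (hemb k)).1 (hw k).1
    exact h1.mono_measure (Measure.restrict_mono Ioc_subset_Icc_self le_rfl)
  have hm := aesm_apply R hRc hwm
  have hl : ∫⁻ s in Ioi 0, ‖R s (w s)‖ₑ ≤ ENNReal.ofReal (∑' k : ℕ,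
      2 * (luxNorm qe (fun x => ‖R (x + (k : ℝ))‖) * luxNorm p (fun x => w (k + x)))) := by
    rw [ENNReal.ofReal_tsum_of_nonneg hnn hsum]
    nth_rewrite 1 [Ioi_eq_iUnion]
    refine (lintegral_iUnion_le _ _).trans (ENNReal.tsum_le_tsum fun k => ?_)
    calc _ ≤ ∫⁻ s in Icc (k:ℝ) (k+1), ‖R s (w s)‖ₑ :=
          lintegral_mono_set Ioc_subset_Icc_self
      _ = ∫⁻ x in Icc (0:ℝ) 1, ‖R (k + x) (w (k + x))‖ₑ := by
          rw [← (hmp k).setLIntegral_comp_preimage_emb (hemb k) (fun s => ‖R s (w s)‖ₑ), hpre]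
      _ ≤ ∫⁻ x in Icc (0:ℝ) 1, ‖‖R (x + k)‖‖ₑ * ‖w (k + x)‖ₑ := by
          apply lintegral_mono
          intro x
          beta_reduce
          rw [enorm_norm, add_comm x]
          exact (R (k + x)).le_opENorm _
      _ ≤ _ := holder_lux hpm hp1 hq1 hconj (hw k) (hRmem k)
  refine ⟨⟨hm, lt_of_le_of_lt hl ENNReal.ofReal_lt_top⟩, ?_⟩
  have h3 := (enorm_integral_le_lintegral_enorm (μ := volume.restrict (Ioi (0:ℝ)))
    (fun s => R s (w s))).trans hl
  rw [← ofReal_norm] at h3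
  exact (ENNReal.ofReal_le_ofReal_iff (tsum_nonneg hnn)).1 h3

lemma conv_tendsto_s17 {X Y : Type*} [NormedAddCommGroup X] [NormedSpace ℂ X]
    [NormedAddCommGroup Y] [NormedSpace ℂ Y]
    {p qe : ℝ → ℝ≥0∞} (hpm : Measurable p)
    (hp1 : ∀ᵐ x ∂(volume.restrict (Set.Icc (0:ℝ) 1)), 1 ≤ p x)
    (hq1 : ∀ᵐ x ∂(volume.restrict (Set.Icc (0:ℝ) 1)), 1 ≤ qe x)
    (hconj : ∀ᵐ x ∂(volume.restrict (Set.Icc (0:ℝ) 1)), 1 / p x + 1 / qe x = 1)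
    (R : ℝ → X →L[ℂ] Y)
    (hRc : ∀ v : X, ContinuousOn (fun t => R t v) (Set.Ioi 0))
    (hRmem : ∀ k : ℕ, MemLpVar qe (fun x => ‖R (x + (k : ℝ))‖))
    (hRsum : Summable (fun k : ℕ => luxNorm qe (fun x => ‖R (x + (k : ℝ))‖)))
    {ι : Type*} {l : Filter ι}
    {w : ι → ℝ → X} (hw : ∀ i, ∀ k : ℕ, MemLpVar p (fun x => w i (k + x))) {B : ℝ}
    (hB : ∀ i, ∀ k : ℕ, luxNorm p (fun x => w i (k + x)) ≤ B)
    {v : ℝ → X} (hv : ∀ k : ℕ, MemLpVar p (fun x => v (k + x))) {C : ℝ}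
    (hC : ∀ k : ℕ, luxNorm p (fun x => v (k + x)) ≤ C)
    (hlim : ∀ k : ℕ, Tendsto (fun i => luxNorm p (fun x => w i (k + x) - v (k + x))) l (𝓝 0)) :
    Tendsto (fun i => ∫ s in Ioi 0, R s (w i s)) l (𝓝 (∫ s in Ioi 0, R s (v s))) := by
  have hd : ∀ i, ∀ k : ℕ, MemLpVar p (fun x => w i (k + x) - v (k + x)) := fun i k =>
    (hw i k).sub hpm (hv k)
  have hdB : ∀ i, ∀ k : ℕ, luxNorm p (fun x => w i (k + x) - v (k + x)) ≤ 2 * (B + C + 2) := by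
    intro i k
    have := luxNorm_sub_le hpm hp1 (hw i k) (hv k)
    have := hB i k
    have := hC k
    linarith
  rw [tendsto_iff_norm_sub_tendsto_zero]
  have hz : Tendsto (fun i => ∑' k : ℕ, 2 * (luxNorm qe (fun x => ‖R (x + (k : ℝ))‖) *
      luxNorm p (fun x => w i (k + x) - v (k + x)))) l (𝓝 0) := by
    have := tendsto_tsum_of_dominated_convergence (𝓕 := l)
      (f := fun i (k : ℕ) => 2 * (luxNorm qe (fun x => ‖R (x + (k : ℝ))‖) *
        luxNorm p (fun x => w i (k + x) - v (k + x)))) (g := fun _ => 0)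
      (bound := fun k : ℕ => 2 * (luxNorm qe (fun x => ‖R (x + (k : ℝ))‖) * (2 * (B + C + 2))))
      ((hRsum.mul_right _).mul_left 2)
      (fun k => by simpa using ((hlim k).const_mul (luxNorm qe (fun x => ‖R (x + (k : ℝ))‖))).const_mul 2)
      (Eventually.of_forall fun i k => by
        rw [Real.norm_of_nonneg (mul_nonneg zero_le_two
          (mul_nonneg (luxNorm_nonneg _ _) (luxNorm_nonneg _ _)))]
        exact mul_le_mul_of_nonneg_left (mul_le_mul_of_nonneg_left (hdB i k)
          (luxNorm_nonneg _ _)) zero_le_two)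
    simpa using this
  refine squeeze_zero (fun _ => norm_nonneg _) (fun i => ?_) hz
  have h1 := (conv_bound_s17 hpm hp1 hq1 hconj R hRc hRmem hRsum (hw i) (hB i)).1
  have h2 := (conv_bound_s17 hpm hp1 hq1 hconj R hRc hRmem hRsum hv hC).1
  rw [← integral_sub h1 h2]
  have h3 := (conv_bound_s17 hpm hp1 hq1 hconj R hRc hRmem hRsum
    (w := fun s => w i s - v s) (hd i) (hdB i)).2
  simpa only [map_sub] using h3

lemma conv_change {X Y : Type*} [NormedAddCommGroup X] [NormedSpace ℂ X]
    [NormedAddCommGroup Y] [NormedSpace ℂ Y] (R : ℝ → X →L[ℂ] Y) (g : ℝ → X) (t : ℝ) :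
    (∫ s in Iic t, R (t - s) (g s)) = ∫ s in Ioi 0, R s (g (t - s)) := by
  have hpre : (fun s : ℝ => t - s) ⁻¹' (Ioi 0) = Iio t := by ext; simp
  rw [integral_Iic_eq_integral_Iio, ← hpre,
    ← (volume.measurePreserving_sub_left t).setIntegral_preimage_emb
    (measurableEmbedding_subLeft t) (fun s => R s (g (t - s))) (Ioi 0)]
  simp

lemma conv_change_int {X Y : Type*} [NormedAddCommGroup X] [NormedSpace ℂ X]
    [NormedAddCommGroup Y] [NormedSpace ℂ Y] (R : ℝ → X →L[ℂ] Y) (g : ℝ → X) (t : ℝ)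
    (h : IntegrableOn (fun s => R s (g (t - s))) (Ioi 0)) :
    IntegrableOn (fun s => R (t - s) (g s)) (Iic t) := by
  have hpre : (fun s : ℝ => t - s) ⁻¹' (Ioi 0) = Iio t := by ext; simp
  rw [integrableOn_Iic_iff_integrableOn_Iio, ← hpre]
  have := ((volume.measurePreserving_sub_left t).integrableOn_comp_preimage
    (measurableEmbedding_subLeft t) (f := fun s => R s (g (t - s))) (s := Ioi 0)).2 h
  simpa [Function.comp_def] using this

/-- same conclusion as Statement 16 for general measurable p : [0,1] → [1,∞],
assuming additionally that the translation map t ↦ ǧ(·-t) is continuous into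
L^{p(x)}([0,1]:X). -/
theorem convolution_product_almost_automorphic_general_exponent
    {X Y : Type*} [NormedAddCommGroup X] [NormedSpace ℂ X] [CompleteSpace X]
    [NormedAddCommGroup Y] [NormedSpace ℂ Y] [CompleteSpace Y]
    (p qe : ℝ → ℝ≥0∞) (hpmeas : Measurable p) (hqemeas : Measurable qe)
    (hp1 : ∀ x ∈ Set.Icc (0:ℝ) 1, 1 ≤ p x)
    (hconj : ∀ᵐ x ∂(MeasureTheory.volume.restrict (Set.Icc (0:ℝ) 1)),
      1 / p x + 1 / qe x = 1)
    (R : ℝ → X →L[ℂ] Y)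
    (hRc : ∀ v : X, ContinuousOn (fun t => R t v) (Set.Ioi 0))
    (hRmem : ∀ k : ℕ, MemLpVar qe (fun x => ‖R (x + (k : ℝ))‖))
    (hRsum : Summable (fun k : ℕ => luxNorm qe (fun x => ‖R (x + (k : ℝ))‖)))
    (g : ℝ → X) (hg : AASVar p (fun t => g (-t)))
    (htrans : ∀ t : ℝ, Filter.Tendsto
      (fun s => luxNorm p (fun x => g (s - x) - g (t - x))) (nhds t) (nhds 0)) :
    (∀ t : ℝ, MeasureTheory.IntegrableOn (fun s => R (t - s) (g s)) (Set.Iic t)) ∧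
    AlmostAutomorphic (fun t => ∫ s in Set.Iic t, R (t - s) (g s)) := by
  have hp1' : ∀ᵐ x ∂(volume.restrict (Set.Icc (0:ℝ) 1)), 1 ≤ p x :=
    (ae_restrict_iff' measurableSet_Icc).2 (Eventually.of_forall hp1)
  have hq1 : ∀ᵐ x ∂(volume.restrict (Set.Icc (0:ℝ) 1)), 1 ≤ qe x := by
    filter_upwards [hconj] with x hx
    have h1 : 1 / qe x ≤ 1 := le_of_le_of_eq le_add_self hx
    simpa using h1
  obtain ⟨⟨hgm, B, hB⟩, hgs⟩ := hg
  have hgm' : ∀ t : ℝ, ∀ k : ℕ, MemLpVar p (fun x => g (t - (k + x))) := by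
    intro t k
    have e : (fun x : ℝ => g (t - (k + x))) = fun x => g (-((k - t) + x)) := by
      funext x; congr 1; ring
    rw [e]; exact hgm _ (mem_univ _)
  have hgB : ∀ t : ℝ, ∀ k : ℕ, luxNorm p (fun x => g (t - (k + x))) ≤ B := by
    intro t k
    have e : (fun x : ℝ => g (t - (k + x))) = fun x => g (-((k - t) + x)) := by
      funext x; congr 1; ring
    rw [e]; exact hB ⟨k - t, mem_univ _, rfl⟩
  refine ⟨fun t => conv_change_int R g t (conv_bound_s17 hpmeas hp1' hq1 hconj R hRc hRmem hRsum
    (w := fun s => g (t - s)) (hgm' t) (hgB t)).1, ?_, ?_⟩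
  · simp only [conv_change]
    rw [continuous_iff_continuousAt]
    intro t
    refine conv_tendsto_s17 hpmeas hp1' hq1 hconj R hRc hRmem hRsum
      (w := fun t s => g (t - s)) hgm' hgB (v := fun s => g (t - s)) (hgm' t) (hgB t) ?_
    intro k
    have h1 : Tendsto (fun s : ℝ => s - k) (𝓝 t) (𝓝 (t - k)) :=
      (continuous_id.sub continuous_const).tendsto t
    have h2 := (htrans (t - k)).comp h1
    simpa only [Function.comp_def, sub_sub] using h2
  · intro b
    obtain ⟨n, hn, h, ⟨hhm, C, hC⟩, hlim⟩ := hgs (fun i => - b i)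
    have hhm' : ∀ t : ℝ, ∀ k : ℕ, MemLpVar p (fun x => h (-(t - (k + x)))) := by
      intro t k
      have e : (fun x : ℝ => h (-(t - (k + x)))) = fun x => h ((k - t) + x) := by
        funext x; congr 1; ring
      rw [e]; exact hhm _ (mem_univ _)
    have hhB : ∀ t : ℝ, ∀ k : ℕ, luxNorm p (fun x => h (-(t - (k + x)))) ≤ C := by
      intro t k
      have e : (fun x : ℝ => h (-(t - (k + x)))) = fun x => h ((k - t) + x) := by
        funext x; congr 1; ring
      rw [e]; exact hC ⟨k - t, mem_univ _, rfl⟩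
    refine ⟨n, hn, fun t => ∫ s in Iic t, R (t - s) (h (-s)), ?_, ?_⟩
    · intro t
      simp only [conv_change, conv_change R (fun s => h (-s))]
      refine conv_tendsto_s17 hpmeas hp1' hq1 hconj R hRc hRmem hRsum
        (w := fun i s => g (t + b (n i) - s)) (fun i => hgm' _) (fun i => hgB _)
        (v := fun s => h (-(t - s))) (hhm' t) (hhB t) ?_
      intro k
      have h1 := (hlim (k - t)).1
      convert h1 using 4 with i x
      all_goals (congr 2 <;> first | rfl | (congr 1; ring))
    · intro t
      simp only [conv_change, conv_change R (fun s => h (-s))]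
      refine conv_tendsto_s17 hpmeas hp1' hq1 hconj R hRc hRmem hRsum
        (w := fun i s => h (-(t - b (n i) - s))) (fun i => hhm' _) (fun i => hhB _)
        (v := fun s => g (t - s)) (hgm' t) (hgB t) ?_
      intro k
      have h1 := (hlim (k - t)).2
      convert h1 using 4 with i x
      all_goals (congr 2 <;> first | rfl | (congr 1; ring))

end
end

section
/- For every real number p > 1 there exists a function f : ℝ → ℝ which is Stepanov p-bounded and Stepanov 1-almost automorphic but not Stepanov p-almost automorphic. -/
open MeasureTheory Filter Topology Set
open scoped ENNReal

noncomputable section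

/-- f belongs to L^r_loc(ℝ:ℝ): measurable with |f|^r locally integrable. -/
def LocLr (r : ℝ) (f : ℝ → ℝ) : Prop :=
  Measurable f ∧ ∀ a b : ℝ, MeasureTheory.IntegrableOn (fun s => |f s| ^ r) (Set.Ioc a b)

/-- Stepanov r-boundedness for a constant exponent r (classical definition). -/
def SpBddConst (r : ℝ) (f : ℝ → ℝ) : Prop :=
  LocLr r f ∧ ∃ C : ℝ, ∀ t : ℝ, (∫ s in Set.Ioc t (t + 1), |f s| ^ r) ≤ C

/-- Stepanov r-almost automorphy for a constant exponent r (classical definition). -/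
def SpAAConst (r : ℝ) (f : ℝ → ℝ) : Prop :=
  LocLr r f ∧
    ∀ a : ℕ → ℝ, ∃ n : ℕ → ℕ, StrictMono n ∧ ∃ g : ℝ → ℝ, LocLr r g ∧
      ∀ t : ℝ,
        Filter.Tendsto (fun k => ∫ s in Set.Ioc t (t + 1), |f (a (n k) + s) - g s| ^ r)
          Filter.atTop (nhds 0) ∧
        Filter.Tendsto (fun k => ∫ s in Set.Ioc t (t + 1), |g (s - a (n k)) - f s| ^ r)
          Filter.atTop (nhds 0)

instance fact2 : Fact (Nat.Prime 2) := ⟨Nat.prime_two⟩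

def FF (p : ℝ) (z : ℤ_[2]) (x : ℝ) : ℝ :=
  if Int.fract x < ‖z + ((⌊x⌋ : ℤ) : ℤ_[2])‖ then ‖z + ((⌊x⌋ : ℤ) : ℤ_[2])‖ ^ (-1 / p) else 0

lemma FF_meas (p : ℝ) (z : ℤ_[2]) : Measurable (FF p z) := by
  have h1 : Measurable (fun x : ℝ => ‖z + ((⌊x⌋ : ℤ) : ℤ_[2])‖) :=
    (measurable_from_top (f := fun j : ℤ => ‖z + (j : ℤ_[2])‖)).comp Int.measurable_floor
  unfold FF
  exact Measurable.ite (measurableSet_lt measurable_fract h1) (h1.pow_const _) measurable_const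

lemma FF_nonneg (p : ℝ) (z : ℤ_[2]) (x : ℝ) : 0 ≤ FF p z x := by
  unfold FF
  split_ifs <;> positivity

lemma FF_le (p : ℝ) (hp : 1 < p) (z : ℤ_[2]) (x : ℝ) : FF p z x ≤ FF p z x ^ p := by
  unfold FF
  split_ifs with h
  · have h0 : 0 < ‖z + ((⌊x⌋ : ℤ) : ℤ_[2])‖ := lt_of_le_of_lt (Int.fract_nonneg x) h
    have h1 : 1 ≤ ‖z + ((⌊x⌋ : ℤ) : ℤ_[2])‖ ^ (-1 / p) := by
      apply Real.one_le_rpow_of_pos_of_le_one_of_nonpos h0 (PadicInt.norm_le_one _)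
      apply div_nonpos_of_nonpos_of_nonneg <;> linarith
    exact Real.self_le_rpow_of_one_le h1 hp.le
  · rw [Real.zero_rpow (by linarith)]

lemma FF_shift (p : ℝ) (z : ℤ_[2]) (m : ℤ) (x : ℝ) :
    FF p z (m + x) = FF p (z + (m : ℤ_[2])) x := by
  unfold FF
  rw [Int.floor_intCast_add, Int.fract_intCast_add]
  push_cast
  rw [add_assoc]

lemma FF_cell (p : ℝ) (hp : 1 < p) (z : ℤ_[2]) (j : ℤ) :
    ∫⁻ x in Ico (j : ℝ) (j + 1), ENNReal.ofReal (FF p z x ^ p) =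
      ENNReal.ofReal (‖z + (j : ℤ_[2])‖⁻¹) * ENNReal.ofReal ‖z + (j : ℤ_[2])‖ := by
  set r := ‖z + (j : ℤ_[2])‖ with hr
  have hr0 : 0 ≤ r := norm_nonneg _
  have hr1 : r ≤ 1 := PadicInt.norm_le_one _
  have : ∫⁻ x in Ico (j : ℝ) (j + 1), ENNReal.ofReal (FF p z x ^ p) =
      ∫⁻ x in Ico (j : ℝ) (j + 1), (Ico (j : ℝ) (j + r)).indicator
        (fun _ => ENNReal.ofReal r⁻¹) x := by
    apply setLIntegral_congr_fun measurableSet_Ico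
    intro x hx
    have hf : ⌊x⌋ = j := Int.floor_eq_iff.2 ⟨hx.1, hx.2⟩
    have hfr : Int.fract x = x - j := by rw [Int.fract, hf]
    simp only [FF, hf, hfr, ← hr]
    by_cases h : x - j < r
    · have hrp : 0 < r := by linarith [hx.1]
      rw [if_pos h, indicator_of_mem (show x ∈ Ico (j : ℝ) (j + r) from ⟨hx.1, by linarith⟩), ← Real.rpow_mul hr0,
        div_mul_cancel₀ _ (by linarith), Real.rpow_neg_one]
    · rw [if_neg h, indicator_of_notMem (fun (h' : x ∈ Ico (j : ℝ) (j + r)) => h (by linarith [h'.2])),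
        Real.zero_rpow (by linarith)]
      simp
  rw [this, lintegral_indicator measurableSet_Ico, Measure.restrict_restrict measurableSet_Ico,
    setLIntegral_const, inter_eq_left.2 (Ico_subset_Ico_right (by linarith)), Real.volume_Ico]
  simp

lemma FF_cell_le (p : ℝ) (hp : 1 < p) (z : ℤ_[2]) (j : ℤ) :
    ∫⁻ x in Ico (j : ℝ) (j + 1), ENNReal.ofReal (FF p z x ^ p) ≤ 1 := by
  rw [FF_cell p hp, ← ENNReal.ofReal_mul (by positivity)]
  rw [ENNReal.ofReal_le_one]
  exact inv_mul_le_one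

lemma FF_unit (p : ℝ) (hp : 1 < p) (z : ℤ_[2]) (t : ℝ) :
    ∫⁻ x in Ioc t (t + 1), ENNReal.ofReal (FF p z x ^ p) ≤ 2 := by
  have hsub : Ioc t (t + 1) ⊆ Ico ((⌊t⌋ : ℤ) : ℝ) ((⌊t⌋ : ℤ) + 1) ∪
      Ico ((⌊t⌋ + 1 : ℤ) : ℝ) ((⌊t⌋ + 1 : ℤ) + 1) := by
    intro x hx
    have h1 := Int.floor_le t
    have h2 := Int.lt_floor_add_one t
    push_cast
    rcases lt_or_ge x (⌊t⌋ + 1) with h | h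
    · exact Or.inl ⟨by linarith [hx.1], h⟩
    · exact Or.inr ⟨h, by linarith [hx.2]⟩
  calc _ ≤ _ := lintegral_mono_set hsub
    _ ≤ _ := lintegral_union_le _ _ _
    _ ≤ 1 + 1 := add_le_add (FF_cell_le p hp z _) (FF_cell_le p hp z _)
    _ = 2 := by norm_num

lemma FFp_meas (p : ℝ) (z : ℤ_[2]) : Measurable (fun x => FF p z x ^ p) :=
  (FF_meas p z).pow_const _

lemma FF_int_unit (p : ℝ) (hp : 1 < p) (z : ℤ_[2]) (t : ℝ) :
    IntegrableOn (fun x => FF p z x ^ p) (Ioc t (t + 1)) := by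
  refine ⟨(FFp_meas p z).aestronglyMeasurable, ?_⟩
  rw [hasFiniteIntegral_iff_ofReal (ae_of_all _ fun x => Real.rpow_nonneg (FF_nonneg p z x) _)]
  exact lt_of_le_of_lt (FF_unit p hp z t) (by norm_num)

lemma FF_int (p : ℝ) (hp : 1 < p) (z : ℤ_[2]) (a b : ℝ) :
    IntegrableOn (fun x => FF p z x ^ p) (Ioc a b) := by
  have hl : LocallyIntegrable (fun x => FF p z x ^ p) volume := by
    intro x
    refine ⟨Ioc (x - 1/2) (x - 1/2 + 1), Ioc_mem_nhds (by linarith) (by linarith),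
      FF_int_unit p hp z _⟩
  exact (hl.integrableOn_isCompact (isCompact_Icc (a := a) (b := b))).mono_set Ioc_subset_Icc_self

lemma FF_bd (p : ℝ) (hp : 1 < p) (z : ℤ_[2]) (t : ℝ) :
    ∫ x in Ioc t (t + 1), FF p z x ^ p ≤ 2 := by
  rw [integral_eq_lintegral_of_nonneg_ae
    (ae_of_all _ fun x => Real.rpow_nonneg (FF_nonneg p z x) _)
    (FFp_meas p z).aestronglyMeasurable]
  have := ENNReal.toReal_mono (by norm_num) (FF_unit p hp z t)
  simpa using this

lemma FF_int_shift (p : ℝ) (hp : 1 < p) (z : ℤ_[2]) (θ t : ℝ) :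
    IntegrableOn (fun x => FF p z (x + θ) ^ p) (Ioc t (t + 1)) := by
  have h : IntervalIntegrable (fun x => FF p z x ^ p) volume (t + θ) (t + 1 + θ) := by
    rw [intervalIntegrable_iff_integrableOn_Ioc_of_le (by linarith)]
    exact FF_int p hp z _ _
  have := h.comp_add_right θ
  rw [intervalIntegrable_iff_integrableOn_Ioc_of_le (by linarith)] at this
  simpa using this

lemma FF_bd_shift (p : ℝ) (hp : 1 < p) (z : ℤ_[2]) (θ t : ℝ) :
    ∫ x in Ioc t (t + 1), FF p z (x + θ) ^ p ≤ 2 := by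
  rw [← intervalIntegral.integral_of_le (by linarith),
    intervalIntegral.integral_comp_add_right (fun x => FF p z x ^ p),
    intervalIntegral.integral_of_le (by linarith)]
  have := FF_bd p hp z (t + θ)
  rwa [show t + θ + 1 = t + 1 + θ by ring] at this

lemma FF_loc_p (p : ℝ) (hp : 1 < p) (z : ℤ_[2]) : LocLr p (FF p z) := by
  refine ⟨FF_meas p z, fun a b => ?_⟩
  simp only [abs_of_nonneg (FF_nonneg p z _)]
  exact FF_int p hp z a b

lemma FF_loc_one (p : ℝ) (hp : 1 < p) (z : ℤ_[2]) (θ : ℝ) :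
    LocLr 1 (fun s => FF p z (s + θ)) := by
  have hm : Measurable (fun s => FF p z (s + θ)) := (FF_meas p z).comp (measurable_add_const θ)
  refine ⟨hm, fun a b => ?_⟩
  simp only [abs_of_nonneg (FF_nonneg p z _), Real.rpow_one]
  have hl : LocallyIntegrable (fun s => FF p z (s + θ)) volume := by
    intro x
    refine ⟨Ioc (x - 1/2) (x - 1/2 + 1), Ioc_mem_nhds (by linarith) (by linarith), ?_⟩
    refine (FF_int_shift p hp z θ _).mono' hm.aestronglyMeasurable (ae_of_all _ fun s => ?_)
    rw [Real.norm_of_nonneg (FF_nonneg _ _ _)]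
    exact FF_le p hp z _
  exact (hl.integrableOn_isCompact (isCompact_Icc (a := a) (b := b))).mono_set Ioc_subset_Icc_self

lemma FF_pt (p : ℝ) (z : ℤ_[2]) (zn : ℕ → ℤ_[2]) (hz : Tendsto zn atTop (𝓝 z))
    (y : ℝ) (yn : ℕ → ℝ) (hy : Tendsto yn atTop (𝓝 y))
    (h1 : y ≠ (⌊y⌋ : ℤ)) (h2 : y ≠ (⌊y⌋ : ℤ) + ‖z + ((⌊y⌋ : ℤ) : ℤ_[2])‖) :
    Tendsto (fun k => FF p (zn k) (yn k)) atTop (𝓝 (FF p z y)) := by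
  set j := ⌊y⌋ with hj
  have hr : Tendsto (fun k => ‖zn k + (j : ℤ_[2])‖) atTop (𝓝 ‖z + (j : ℤ_[2])‖) :=
    (hz.add_const _).norm
  have hfl : ∀ᶠ k in atTop, ⌊yn k⌋ = j := by
    have : Ioo (j : ℝ) (j + 1) ∈ 𝓝 y :=
      Ioo_mem_nhds (lt_of_le_of_ne (Int.floor_le y) (Ne.symm h1)) (Int.lt_floor_add_one y)
    filter_upwards [hy this] with k hk
    exact Int.floor_eq_iff.2 ⟨hk.1.le, hk.2⟩
  have hd : Tendsto (fun k => yn k - j) atTop (𝓝 (y - j)) := hy.sub_const _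
  rcases lt_or_gt_of_ne h2 with h | h
  · have hlt : y - j < ‖z + (j : ℤ_[2])‖ := by linarith
    have hpos : 0 < ‖z + (j : ℤ_[2])‖ := by
      have := Int.floor_le y
      linarith
    have hF : FF p z y = ‖z + (j : ℤ_[2])‖ ^ (-1 / p) := by
      unfold FF
      rw [if_pos]
      exact hlt
    rw [hF]
    refine Tendsto.congr' ?_ (hr.rpow_const (Or.inl hpos.ne'))
    filter_upwards [hfl, hd.eventually_lt hr hlt] with k hk hk2
    unfold FF
    rw [Int.fract, hk, if_pos hk2]
  · have hlt : ‖z + (j : ℤ_[2])‖ < y - j := by linarith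
    have hF : FF p z y = 0 := by
      unfold FF
      rw [if_neg]
      exact not_lt.2 hlt.le
    rw [hF]
    refine Tendsto.congr' ?_ tendsto_const_nhds
    filter_upwards [hfl, hr.eventually_lt hd hlt] with k hk hk2
    unfold FF
    rw [Int.fract, hk, if_neg (not_lt.2 hk2.le)]

lemma FF_ae (p : ℝ) (z : ℤ_[2]) (zn : ℕ → ℤ_[2]) (hz : Tendsto zn atTop (𝓝 z))
    (θ : ℝ) (θn : ℕ → ℝ) (hθ : Tendsto θn atTop (𝓝 θ)) :
    ∀ᵐ s : ℝ, Tendsto (fun k => FF p (zn k) (s + θn k)) atTop (𝓝 (FF p z (s + θ))) := by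
  have hc : ((range fun j : ℤ => (j : ℝ) - θ) ∪
      (range fun j : ℤ => (j : ℝ) + ‖z + (j : ℤ_[2])‖ - θ)).Countable :=
    (countable_range _).union (countable_range _)
  filter_upwards [hc.ae_notMem volume] with s hs
  apply FF_pt p z zn hz _ _ (hθ.const_add s)
  · intro h
    exact hs (Or.inl ⟨_, by simp only []; rw [← h]; ring⟩)
  · intro h
    exact hs (Or.inr ⟨_, by simp only []; rw [← h]; ring⟩)

lemma trunc_ineq (p M A B : ℝ) (hp : 1 < p) (hM : 0 < M) (hA : 0 ≤ A) (hB : 0 ≤ B) :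
    |A - B| ≤ |min A M - min B M| + M ^ (1 - p) * (A ^ p + B ^ p) := by
  have key : ∀ C : ℝ, 0 ≤ C → |C - min C M| ≤ M ^ (1 - p) * C ^ p := by
    intro C hC
    rcases le_total C M with h | h
    · rw [min_eq_left h]
      simp only [sub_self, abs_zero]
      positivity
    · rw [min_eq_right h, abs_of_nonneg (by linarith)]
      have hC0 : 0 < C := by linarith
      have e : C = C ^ (1 - p) * C ^ p := by
        rw [← Real.rpow_add hC0]; simp
      have : C ^ (1 - p) ≤ M ^ (1 - p) := Real.rpow_le_rpow_of_nonpos hM h (by linarith)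
      have h3 : C ^ (1 - p) * C ^ p ≤ M ^ (1 - p) * C ^ p :=
        mul_le_mul_of_nonneg_right this (by positivity)
      linarith
  have e : A - B = (A - min A M) + (min A M - min B M) - (B - min B M) := by ring
  have h1 := key A hA
  have h2 := key B hB
  calc |A - B| ≤ |A - min A M| + |min A M - min B M| + |B - min B M| := by
        rw [e]
        exact (abs_sub _ _).trans (by gcongr; exact abs_add_le _ _)
    _ ≤ _ := by linarith

lemma FF_main (p : ℝ) (hp : 1 < p) (z : ℤ_[2]) (zn : ℕ → ℤ_[2]) (hz : Tendsto zn atTop (𝓝 z))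
    (θ : ℝ) (θn : ℕ → ℝ) (hθ : Tendsto θn atTop (𝓝 θ)) (t : ℝ) :
    Tendsto (fun k => ∫ s in Ioc t (t + 1), |FF p (zn k) (s + θn k) - FF p z (s + θ)| ^ (1 : ℝ))
      atTop (𝓝 0) := by
  simp only [Real.rpow_one]
  have hms : ∀ z θ, Measurable (fun s => FF p z (s + θ)) := fun z θ =>
    (FF_meas p z).comp (measurable_add_const θ)
  have htr : ∀ M : ℝ, 0 < M → Tendsto (fun k => ∫ s in Ioc t (t + 1),
      |min (FF p (zn k) (s + θn k)) M - min (FF p z (s + θ)) M|) atTop (𝓝 0) := by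
    intro M hM
    have := tendsto_integral_of_dominated_convergence (μ := volume.restrict (Ioc t (t + 1)))
      (F := fun k s => |min (FF p (zn k) (s + θn k)) M - min (FF p z (s + θ)) M|)
      (f := fun _ => (0 : ℝ)) (fun _ => M)
      (fun k => ((((hms _ _).min measurable_const).sub
        ((hms _ _).min measurable_const)).abs).aestronglyMeasurable)
      (integrable_const M) ?_ ?_
    · simpa using this
    · intro k
      refine ae_of_all _ fun s => ?_
      rw [Real.norm_eq_abs, abs_abs, abs_sub_le_iff]
      have a1 : 0 ≤ min (FF p (zn k) (s + θn k)) M := le_min (FF_nonneg _ _ _) hM.le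
      have a2 : 0 ≤ min (FF p z (s + θ)) M := le_min (FF_nonneg _ _ _) hM.le
      constructor <;> linarith [min_le_right (FF p (zn k) (s + θn k)) M,
        min_le_right (FF p z (s + θ)) M]
    · filter_upwards [ae_restrict_of_ae (FF_ae p z zn hz θ θn hθ)] with s hs
      have := ((hs.min (tendsto_const_nhds (x := M))).sub_const (min (FF p z (s + θ)) M)).abs
      simpa using this
  have hle : ∀ M : ℝ, 0 < M → ∀ k, ∫ s in Ioc t (t + 1), |FF p (zn k) (s + θn k) - FF p z (s + θ)|
      ≤ (∫ s in Ioc t (t + 1), |min (FF p (zn k) (s + θn k)) M - min (FF p z (s + θ)) M|)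
        + M ^ (1 - p) * 4 := by
    intro M hM k
    have i1 := FF_int_shift p hp (zn k) (θn k) t
    have i2 := FF_int_shift p hp z θ t
    have b1 := FF_bd_shift p hp (zn k) (θn k) t
    have b2 := FF_bd_shift p hp z θ t
    have i3 : IntegrableOn (fun s => |min (FF p (zn k) (s + θn k)) M - min (FF p z (s + θ)) M|)
        (Ioc t (t + 1)) := by
      refine (integrable_const M).mono' ((((hms _ _).min measurable_const).sub
        ((hms _ _).min measurable_const)).abs).aestronglyMeasurable (ae_of_all _ fun s => ?_)
      rw [Real.norm_eq_abs, abs_abs, abs_sub_le_iff]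
      have a1 : 0 ≤ min (FF p (zn k) (s + θn k)) M := le_min (FF_nonneg _ _ _) hM.le
      have a2 : 0 ≤ min (FF p z (s + θ)) M := le_min (FF_nonneg _ _ _) hM.le
      constructor <;> linarith [min_le_right (FF p (zn k) (s + θn k)) M,
        min_le_right (FF p z (s + θ)) M]
    have i4 : IntegrableOn (fun s => M ^ (1 - p) *
        (FF p (zn k) (s + θn k) ^ p + FF p z (s + θ) ^ p)) (Ioc t (t + 1)) :=
      (i1.add i2).const_mul _
    calc _ ≤ ∫ s in Ioc t (t + 1), (|min (FF p (zn k) (s + θn k)) M - min (FF p z (s + θ)) M| +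
          M ^ (1 - p) * (FF p (zn k) (s + θn k) ^ p + FF p z (s + θ) ^ p)) := by
          apply integral_mono_of_nonneg (ae_of_all _ fun s => abs_nonneg _) (i3.add i4)
          exact ae_of_all _ fun s => trunc_ineq p M _ _ hp hM (FF_nonneg _ _ _) (FF_nonneg _ _ _)
      _ = _ := by rw [integral_add i3 i4, integral_const_mul, integral_add i1 i2]
      _ ≤ _ := by
          gcongr
          linarith
  rw [Metric.tendsto_atTop]
  intro ε hε
  obtain ⟨M, hM, hMε⟩ : ∃ M : ℝ, 0 < M ∧ M ^ (1 - p) * 4 < ε / 2 := by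
    have h := (tendsto_rpow_neg_atTop (show 0 < p - 1 by linarith)).mul_const 4
    rw [zero_mul] at h
    obtain ⟨M, h1, h2⟩ := ((h.eventually_lt_const (half_pos hε)).and (eventually_gt_atTop 0)).exists
    exact ⟨M, h2, by rwa [neg_sub] at h1⟩
  obtain ⟨N, hN⟩ := eventually_atTop.1 ((htr M hM).eventually_lt_const (half_pos hε))
  refine ⟨N, fun k hk => ?_⟩
  rw [Real.dist_eq, sub_zero, abs_of_nonneg (integral_nonneg fun s => abs_nonneg _)]
  linarith [hN k hk, hle M hM k]

lemma FF_aa (p : ℝ) (hp : 1 < p) : SpAAConst 1 (FF p 0) := by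
  refine ⟨by simpa using FF_loc_one p hp 0 0, fun a => ?_⟩
  obtain ⟨⟨z, θ⟩, -, n, hn, hlim⟩ :=
    ((isCompact_univ (X := ℤ_[2])).prod (isCompact_Icc (a := (0:ℝ)) (b := 1))).tendsto_subseq
      (x := fun k => (((⌊a k⌋ : ℤ) : ℤ_[2]), Int.fract (a k)))
      (fun k => ⟨mem_univ _, Int.fract_nonneg _, (Int.fract_lt_one _).le⟩)
  have hz : Tendsto (fun k => ((⌊a (n k)⌋ : ℤ) : ℤ_[2])) atTop (𝓝 z) :=
    (continuous_fst.tendsto _).comp hlim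
  have hθ : Tendsto (fun k => Int.fract (a (n k))) atTop (𝓝 θ) :=
    (continuous_snd.tendsto _).comp hlim
  refine ⟨n, hn, fun s => FF p z (s + θ), FF_loc_one p hp z θ, fun t => ⟨?_, ?_⟩⟩
  · refine (FF_main p hp z _ hz θ _ hθ t).congr fun k => ?_
    congr 1
    ext s
    have : a (n k) + s = (⌊a (n k)⌋ : ℤ) + (s + Int.fract (a (n k))) := by
      rw [Int.fract]; ring
    rw [this, FF_shift, zero_add]
  · have hz' : Tendsto (fun k => z + ((-⌊a (n k)⌋ : ℤ) : ℤ_[2])) atTop (𝓝 0) := by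
      have := hz.const_sub z
      simpa [sub_eq_add_neg] using this
    have hθ' : Tendsto (fun k => θ - Int.fract (a (n k))) atTop (𝓝 0) := by
      have := hθ.const_sub θ
      simpa using this
    refine (FF_main p hp 0 _ hz' 0 _ hθ' t).congr fun k => ?_
    congr 1
    ext s
    have : s - a (n k) + θ = (-⌊a (n k)⌋ : ℤ) + (s + (θ - Int.fract (a (n k)))) := by
      rw [Int.fract]; push_cast; ring
    beta_reduce
    rw [this, FF_shift, add_zero]

lemma aux_add_rpow (p : ℝ) {a b : ℝ} (ha : 0 ≤ a) (hb : 0 ≤ b) (hp : 1 ≤ p) :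
    (a + b) ^ p ≤ 2 ^ (p - 1) * (a ^ p + b ^ p) := by
  lift a to NNReal using ha
  lift b to NNReal using hb
  exact_mod_cast NNReal.rpow_add_le_mul_rpow_add_rpow a b hp

lemma FF_not (p : ℝ) (hp : 1 < p) : ¬ SpAAConst p (FF p 0) := by
  rintro ⟨-, h⟩
  obtain ⟨n, hn, g, ⟨hgm, hgi⟩, H⟩ := h (fun k => (2 : ℝ) ^ k)
  obtain ⟨H, -⟩ := H 0
  have hp0 : p ≠ 0 := by linarith
  have hsh : ∀ k s, FF p 0 (2 ^ n k + s) = FF p ((2 : ℤ_[2]) ^ n k) s := by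
    intro k s
    have := FF_shift p 0 (2 ^ n k) s
    push_cast at this
    rw [this, zero_add]
  simp only [hsh] at H
  rw [zero_add] at H
  have hz : Tendsto (fun k => (2 : ℤ_[2]) ^ n k) atTop (𝓝 0) := by
    refine (tendsto_pow_atTop_nhds_zero_of_norm_lt_one ?_).comp hn.tendsto_atTop
    have := PadicInt.norm_p (p := 2)
    norm_num at this
    rw [this]; norm_num
  have hF0 : ∀ s ∈ Ico (0:ℝ) 1, FF p 0 s = 0 := by
    intro s hs
    have : ⌊s⌋ = 0 := Int.floor_eq_iff.2 ⟨by simpa using hs.1, by simpa using hs.2⟩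
    unfold FF
    rw [this, if_neg]
    simpa using Int.fract_nonneg s
  have hres : volume.restrict (Ioc (0:ℝ) 1) = volume.restrict (Ico (0:ℝ) 1) :=
    Measure.restrict_congr_set Ico_ae_eq_Ioc.symm
  have hgi1 := hgi 0 1
  rw [hres] at H
  have hgi2 : Integrable (fun s => |g s| ^ p) (volume.restrict (Ico (0:ℝ) 1)) := by
    rw [← hres]; exact hgi1
  -- integrability of the difference
  have hdm : ∀ k, Measurable (fun s => |FF p ((2 : ℤ_[2]) ^ n k) s - g s| ^ p) := fun k =>
    (((FF_meas p _).sub hgm).abs).pow_const p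
  have hFint : ∀ k, Integrable (fun s => FF p ((2 : ℤ_[2]) ^ n k) s ^ p)
      (volume.restrict (Ico (0:ℝ) 1)) := by
    intro k
    rw [← hres]; exact FF_int p hp _ 0 1
  have hdi : ∀ k, Integrable (fun s => |FF p ((2 : ℤ_[2]) ^ n k) s - g s| ^ p)
      (volume.restrict (Ico (0:ℝ) 1)) := by
    intro k
    refine (((hFint k).add hgi2).const_mul (2 ^ (p - 1))).mono'
      (hdm k).aestronglyMeasurable (ae_of_all _ fun s => ?_)
    rw [Real.norm_of_nonneg (by positivity)]
    have h1 : |FF p ((2 : ℤ_[2]) ^ n k) s - g s| ^ p ≤ (FF p ((2 : ℤ_[2]) ^ n k) s + |g s|) ^ p := by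
      refine Real.rpow_le_rpow (abs_nonneg _) ((abs_sub _ _).trans ?_) (by linarith)
      rw [abs_of_nonneg (FF_nonneg _ _ _)]
    exact h1.trans (aux_add_rpow p (FF_nonneg _ _ _) (abs_nonneg _) hp.le)
  have HL : Tendsto (fun k => ∫⁻ s in Ico (0:ℝ) 1,
      ENNReal.ofReal (|FF p ((2 : ℤ_[2]) ^ n k) s - g s| ^ p)) atTop (𝓝 0) := by
    have := ENNReal.tendsto_ofReal H
    rw [ENNReal.ofReal_zero] at this
    refine this.congr fun k => ?_
    exact ofReal_integral_eq_lintegral_ofReal (hdi k) (ae_of_all _ fun s => by positivity)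
  have hg0 : ∫⁻ s in Ico (0:ℝ) 1, ENNReal.ofReal (|g s| ^ p) = 0 := by
    have hF := lintegral_liminf_le (u := atTop) (μ := volume.restrict (Ico (0:ℝ) 1))
      (f := fun k s => ENNReal.ofReal (|FF p ((2 : ℤ_[2]) ^ n k) s - g s| ^ p))
      (fun k => (hdm k).ennreal_ofReal)
    rw [HL.liminf_eq] at hF
    rw [← le_zero_iff]
    refine le_trans (le_of_eq ?_) hF
    apply lintegral_congr_ae
    filter_upwards [ae_restrict_of_ae (FF_ae p 0 _ hz 0 (fun _ => 0) tendsto_const_nhds),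
      ae_restrict_mem measurableSet_Ico] with s hs hs1
    simp only [add_zero] at hs
    rw [hF0 s hs1] at hs
    have := ENNReal.tendsto_ofReal
      (((hs.sub_const (g s)).abs).rpow_const (p := p) (Or.inr (by linarith)))
    rw [this.liminf_eq]
    simp
  have hgae : ∀ᵐ s ∂(volume.restrict (Ico (0:ℝ) 1)), g s = 0 := by
    rw [lintegral_eq_zero_iff ((hgm.abs.pow_const p).ennreal_ofReal)] at hg0
    filter_upwards [hg0] with s hs
    simp only [Pi.zero_apply, ENNReal.ofReal_eq_zero] at hs
    by_contra hne
    have : 0 < |g s| ^ p := Real.rpow_pos_of_pos (abs_pos.2 hne) p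
    linarith
  have hone : ∀ k, ∫⁻ s in Ico (0:ℝ) 1,
      ENNReal.ofReal (|FF p ((2 : ℤ_[2]) ^ n k) s - g s| ^ p) = 1 := by
    intro k
    have hc := FF_cell p hp ((2 : ℤ_[2]) ^ n k) 0
    rw [← ENNReal.ofReal_mul (by positivity), inv_mul_cancel₀ (by simp)] at hc
    simp only [Int.cast_zero, zero_add, ENNReal.ofReal_one] at hc
    rw [← hc]
    apply lintegral_congr_ae
    filter_upwards [hgae] with s hs
    rw [hs, sub_zero, abs_of_nonneg (FF_nonneg _ _ _)]
  simp only [hone] at HL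
  exact one_ne_zero (tendsto_nhds_unique tendsto_const_nhds HL)

/-- for every p > 1 there is a Stepanov p-bounded, Stepanov 1-almost
automorphic function which is not Stepanov p-almost automorphic. -/
theorem exists_stepanov_one_aa_not_stepanov_p_aa :
    ∀ p : ℝ, 1 < p → ∃ f : ℝ → ℝ,
      SpBddConst p f ∧ SpAAConst 1 f ∧ ¬ SpAAConst p f := by
  intro p hp
  refine ⟨FF p 0, ⟨FF_loc_p p hp 0, 2, fun t => ?_⟩, FF_aa p hp, FF_not p hp⟩
  simp only [abs_of_nonneg (FF_nonneg p 0 _)]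
  exact FF_bd p hp 0 t

end
end
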